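/- A countable model M of ZFC has a minimum GBC-realization if and only if M has a global well-order definable from set parameters. In this case, the minimum GBC-realization is Def(M), the collection of classes of M definable from set parameters. -/

import Mathlib

/- A self-contained formalization framework for two-sorted second-order set theories
(Gödel–Bernays `GB`, Kelley–Morse `KM`, Elementary Transfinite Recursion `ETR`, ...).

A model of second-order set theory is given by a carrier type `α`, a domain `D : Set α`
of its sets, a membership relation `E : α → α → Prop`, and a collection
`𝒳 : Set (Set α)` of classes (extensional classes are identified with subsets of the
first-order part). Schemas are formalized via a deep embedding `Fml` of the two-sorted
language: lower-case (set) variables and upper-case (class) variables, both indexed by ℕ. -/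

namespace SOST

/-- Formulas of the two-sorted language of second-order set theory.
`memSS i j` is `xᵢ ∈ xⱼ`, `memSC i j` is `xᵢ ∈ Xⱼ`, `eqS i j` is `xᵢ = xⱼ`,
`allS` quantifies a set variable, `allC` a class variable. -/
inductive Fml : Type
  | memSS : ℕ → ℕ → Fml
  | memSC : ℕ → ℕ → Fml
  | eqS : ℕ → ℕ → Fml
  | fal : Fml
  | imp : Fml → Fml → Fml
  | allS : ℕ → Fml → Fml
  | allC : ℕ → Fml → Fml
deriving DecidableEq

/-- Negation, defined from implication and falsity. -/
def Fml.neg (φ : Fml) : Fml := φ.imp .fal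

variable {α : Type*}

/-- Tarskian satisfaction for the two-sorted language, over the structure with
first-order domain `D`, membership `E` and collection of classes `𝒳`.
Set quantifiers range over `D`; class quantifiers range over `𝒳`.
`s` assigns set variables, `c` assigns class variables. -/
def Sat (D : Set α) (E : α → α → Prop) (𝒳 : Set (Set α)) :
    Fml → (ℕ → α) → (ℕ → Set α) → Prop
  | .memSS i j, s, _ => E (s i) (s j)
  | .memSC i j, s, c => s i ∈ c j
  | .eqS i j, s, _ => s i = s j
  | .fal, _, _ => False
  | .imp φ ψ, s, c => Sat D E 𝒳 φ s c → Sat D E 𝒳 ψ s c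
  | .allS i φ, s, c => ∀ x ∈ D, Sat D E 𝒳 φ (Function.update s i x) c
  | .allC i φ, s, c => ∀ X ∈ 𝒳, Sat D E 𝒳 φ s (Function.update c i X)

/-- A formula is *elementary* (first-order) if it has no class quantifiers
(class variables may still occur freely, as parameters). -/
def Fml.IsElementary : Fml → Prop
  | .memSS _ _ => True
  | .memSC _ _ => True
  | .eqS _ _ => True
  | .fal => True
  | .imp φ ψ => φ.IsElementary ∧ ψ.IsElementary
  | .allS _ φ => φ.IsElementary
  | .allC _ _ => False

/-- A formula is *pure* if it mentions no class variables at all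
(it is a formula of the first-order language of set theory). -/
def Fml.IsPure : Fml → Prop
  | .memSS _ _ => True
  | .memSC _ _ => False
  | .eqS _ _ => True
  | .fal => True
  | .imp φ ψ => φ.IsPure ∧ ψ.IsPure
  | .allS _ φ => φ.IsPure
  | .allC _ _ => False

/-- Π¹₁ formulas: a single universal class quantifier followed by an elementary formula. -/
def Fml.IsPi11 (φ : Fml) : Prop :=
  ∃ (i : ℕ) (ψ : Fml), ψ.IsElementary ∧ φ = Fml.allC i ψ

/-- Σ¹₁ formulas: an existential class quantifier (coded as `¬∀X¬`) followed by an
elementary formula. -/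
def Fml.IsSigma11 (φ : Fml) : Prop :=
  ∃ (i : ℕ) (ψ : Fml), ψ.IsElementary ∧ φ = (Fml.allC i ψ.neg).neg

/-- `x` is internally transitive: members of members (within `D`) are members. -/
def IsTransIn (D : Set α) (E : α → α → Prop) (x : α) : Prop :=
  ∀ y ∈ D, E y x → ∀ z ∈ D, E z y → E z x

/-- `x` is internally a (von Neumann) ordinal: a transitive set of transitive sets. -/
def IsOrdIn (D : Set α) (E : α → α → Prop) (x : α) : Prop :=
  x ∈ D ∧ IsTransIn D E x ∧ ∀ y ∈ D, E y x → IsTransIn D E y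

/-- `p` is internally the Kuratowski ordered pair `⟨a, b⟩ = {{a}, {a, b}}`. -/
def IsKPair (D : Set α) (E : α → α → Prop) (p a b : α) : Prop :=
  p ∈ D ∧ a ∈ D ∧ b ∈ D ∧
    ∀ z ∈ D, (E z p ↔
      ((∀ w ∈ D, E w z ↔ w = a) ∨ (∀ w ∈ D, E w z ↔ (w = a ∨ w = b))))

/-- For a class `R` of (internal) ordered pairs, `PairIn D E R a b` says
that the pair `⟨a, b⟩` belongs to `R`, i.e. `a R b`. -/
def PairIn (D : Set α) (E : α → α → Prop) (R : Set α) (a b : α) : Prop :=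
  ∃ p ∈ R, IsKPair D E p a b

/-- `R` is a class of (internal) ordered pairs, i.e. a class binary relation. -/
def IsClassRel (D : Set α) (E : α → α → Prop) (R : Set α) : Prop :=
  ∀ z ∈ R, ∃ a b, a ∈ D ∧ b ∈ D ∧ IsKPair D E z a b

/-- The field of a class relation `R`. -/
def relFld (D : Set α) (E : α → α → Prop) (R : Set α) : Set α :=
  {a | a ∈ D ∧ ∃ b, PairIn D E R a b ∨ PairIn D E R b a}

/-- The internal (first-order) characterization of well-foundedness for a class
relation `R` over a model of `GB`: every nonempty *set* all of whose members lie
in the field of `R` has an `R`-minimal element. -/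
def IntWF (D : Set α) (E : α → α → Prop) (R : Set α) : Prop :=
  ∀ d ∈ D, (∃ z ∈ D, E z d) → (∀ z ∈ D, E z d → z ∈ relFld D E R) →
    ∃ m ∈ D, E m d ∧ ∀ z ∈ D, E z d → ¬ PairIn D E R z m

/-- The first-order `ZF` axioms, with the Separation and Replacement schemas ranging over
pure formulas of the language of set theory (with set parameters). -/
structure ZFModel (D : Set α) (E : α → α → Prop) : Prop where
  nonempty : ∃ x, x ∈ D
  exten : ∀ x ∈ D, ∀ y ∈ D, (∀ z ∈ D, E z x ↔ E z y) → x = y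
  pairing : ∀ x ∈ D, ∀ y ∈ D, ∃ p ∈ D, ∀ z ∈ D, E z p ↔ (z = x ∨ z = y)
  union : ∀ x ∈ D, ∃ u ∈ D, ∀ z ∈ D, E z u ↔ ∃ w ∈ D, E w x ∧ E z w
  power : ∀ x ∈ D, ∃ p ∈ D, ∀ z ∈ D, E z p ↔ ∀ w ∈ D, E w z → E w x
  infinity : ∃ I ∈ D, (∃ e ∈ D, E e I ∧ ∀ z ∈ D, ¬ E z e) ∧
    ∀ x ∈ D, E x I → ∃ s ∈ D, E s I ∧ ∀ z ∈ D, (E z s ↔ (E z x ∨ z = x))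
  foundation : ∀ x ∈ D, (∃ z ∈ D, E z x) → ∃ m ∈ D, E m x ∧ ∀ z ∈ D, E z m → ¬ E z x
  separation : ∀ φ : Fml, φ.IsPure → ∀ s : ℕ → α, (∀ n, s n ∈ D) → ∀ a ∈ D,
    ∃ b ∈ D, ∀ z ∈ D, E z b ↔
      (E z a ∧ Sat D E ∅ φ (Function.update s 0 z) (fun _ => (∅ : Set α)))
  replacement : ∀ φ : Fml, φ.IsPure → ∀ s : ℕ → α, (∀ n, s n ∈ D) →
    (∀ x ∈ D, ∀ y ∈ D, ∀ y' ∈ D,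
      Sat D E ∅ φ (Function.update (Function.update s 0 x) 1 y) (fun _ => (∅ : Set α)) →
      Sat D E ∅ φ (Function.update (Function.update s 0 x) 1 y') (fun _ => (∅ : Set α)) →
      y = y') →
    ∀ a ∈ D, ∃ b ∈ D, ∀ y ∈ D, E y b ↔ ∃ x ∈ D, E x a ∧
      Sat D E ∅ φ (Function.update (Function.update s 0 x) 1 y) (fun _ => (∅ : Set α))

/-- The Axiom of Choice for sets (choice sets for disjoint families of nonempty sets). -/
def SatAC (D : Set α) (E : α → α → Prop) : Prop :=
  ∀ x ∈ D, (∀ y ∈ D, E y x → ∃ z ∈ D, E z y) →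
    (∀ y ∈ D, ∀ y' ∈ D, E y x → E y' x → (∃ z ∈ D, E z y ∧ E z y') → y = y') →
    ∃ c ∈ D, ∀ y ∈ D, E y x →
      ∃ z ∈ D, E z y ∧ E z c ∧ ∀ w ∈ D, E w y → E w c → w = z

/-- Gödel–Bernays set theory `GB`: ZF for the sets, extensionality for classes
(automatic here since classes are subsets of the first-order part), Class Replacement,
and Elementary Comprehension (for formulas without class quantifiers, allowing
set and class parameters). -/
structure GBModel (D : Set α) (E : α → α → Prop) (𝒳 : Set (Set α)) : Prop where
  classes_sub : ∀ X ∈ 𝒳, X ⊆ D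
  zf : ZFModel D E
  classRepl : ∀ F ∈ 𝒳,
    (∀ x y y', PairIn D E F x y → PairIn D E F x y' → y = y') →
    ∀ a ∈ D, ∃ b ∈ D, ∀ y ∈ D, E y b ↔ ∃ x ∈ D, E x a ∧ PairIn D E F x y
  elemComp : ∀ φ : Fml, φ.IsElementary → ∀ s : ℕ → α, (∀ n, s n ∈ D) →
    ∀ c : ℕ → Set α, (∀ n, c n ∈ 𝒳) →
    ∃ X ∈ 𝒳, ∀ x ∈ D, (x ∈ X ↔ Sat D E 𝒳 φ (Function.update s 0 x) c)

/-- The Comprehension schema restricted to formulas satisfying `P`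
(with set parameters and class parameters from `𝒳`). -/
def Comp (D : Set α) (E : α → α → Prop) (𝒳 : Set (Set α)) (P : Fml → Prop) : Prop :=
  ∀ φ : Fml, P φ → ∀ s : ℕ → α, (∀ n, s n ∈ D) →
    ∀ c : ℕ → Set α, (∀ n, c n ∈ 𝒳) →
    ∃ X ∈ 𝒳, ∀ x ∈ D, (x ∈ X ↔ Sat D E 𝒳 φ (Function.update s 0 x) c)

/-- Kelley–Morse set theory `KM`: `GB` together with full Comprehension for all
second-order formulas. -/
def KMModel (D : Set α) (E : α → α → Prop) (𝒳 : Set (Set α)) : Prop :=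
  GBModel D E 𝒳 ∧ Comp D E 𝒳 (fun _ => True)

/-- Π¹₁-Comprehension. -/
def Pi11CA (D : Set α) (E : α → α → Prop) (𝒳 : Set (Set α)) : Prop :=
  Comp D E 𝒳 Fml.IsPi11

/-- Δ¹₁-Comprehension: if a property of sets is equivalently defined by a Π¹₁ and a
Σ¹₁ formula (with parameters), then the corresponding class exists. -/
def Delta11CA (D : Set α) (E : α → α → Prop) (𝒳 : Set (Set α)) : Prop :=
  ∀ φ ψ : Fml, φ.IsPi11 → ψ.IsSigma11 →
    ∀ s : ℕ → α, (∀ n, s n ∈ D) → ∀ c : ℕ → Set α, (∀ n, c n ∈ 𝒳) →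
    (∀ x ∈ D, Sat D E 𝒳 φ (Function.update s 0 x) c ↔
      Sat D E 𝒳 ψ (Function.update s 0 x) c) →
    ∃ X ∈ 𝒳, ∀ x ∈ D, (x ∈ X ↔ Sat D E 𝒳 φ (Function.update s 0 x) c)

/-- Global Choice: there is a class bijection between the universe `V` and the
class `Ord` of all ordinals. -/
def GlobalChoice (D : Set α) (E : α → α → Prop) (𝒳 : Set (Set α)) : Prop :=
  ∃ F ∈ 𝒳, IsClassRel D E F ∧
    (∀ x y y', PairIn D E F x y → PairIn D E F x y' → y = y') ∧
    (∀ x x' y, PairIn D E F x y → PairIn D E F x' y → x = x') ∧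
    (∀ x ∈ D, ∃ y, PairIn D E F x y ∧ IsOrdIn D E y) ∧
    (∀ y, IsOrdIn D E y → ∃ x ∈ D, PairIn D E F x y)

/-- The `i`-th slice `(C)_i = {y : ⟨i, y⟩ ∈ C}` of a class `C`. -/
def slice (D : Set α) (E : α → α → Prop) (C : Set α) (i : α) : Set α :=
  {y | y ∈ D ∧ PairIn D E C i y}

/-- The restriction `S ↾ r` of a solution class `S` (a class of pairs) to indices
strictly `lt`-below `r`. -/
def sliceRestrict (D : Set α) (E : α → α → Prop) (S : Set α)
    (lt : α → α → Prop) (r : α) : Set α :=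
  {z | z ∈ S ∧ ∃ r' x, lt r' r ∧ IsKPair D E z r' x}

/-- Elementary transfinite recursion along the (external presentation of a) class
relation with field `F` and (transitive) order relation `lt`: for every elementary
formula `φ(x, Y, A)` with class parameter `A ∈ 𝒳` (and set parameters) there is a
solution class `S ∈ 𝒳`, i.e. a class of pairs concentrated on `F` such that for each
`r ∈ F` the slice `S_r` is `{x : φ(x, S ↾ r, A)}`. Class variable `0` is interpreted
by the partial solution `S ↾ r` and the remaining class variables by the parameter. -/
def ETRFor (D : Set α) (E : α → α → Prop) (𝒳 : Set (Set α))
    (F : Set α) (lt : α → α → Prop) : Prop :=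
  ∀ φ : Fml, φ.IsElementary → ∀ A ∈ 𝒳, ∀ s : ℕ → α, (∀ n, s n ∈ D) →
    ∃ S ∈ 𝒳, (∀ z ∈ S, ∃ r x, r ∈ F ∧ x ∈ D ∧ IsKPair D E z r x) ∧
      ∀ r ∈ F, ∀ x ∈ D,
        (PairIn D E S r x ↔
          Sat D E 𝒳 φ (Function.update s 0 x)
            (fun n => if n = 0 then sliceRestrict D E S lt r else A))

/-- The principle `ETR` of Elementary Transfinite Recursion: every elementary recursion
along a class relation in `𝒳` which the model believes to be well-founded has a
solution in `𝒳`. -/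
def ETR (D : Set α) (E : α → α → Prop) (𝒳 : Set (Set α)) : Prop :=
  ∀ R ∈ 𝒳, IsClassRel D E R → IntWF D E R →
    ETRFor D E 𝒳 (relFld D E R) (Relation.TransGen (PairIn D E R))

/-- `x` is internally a natural number: an ordinal all of whose `≤`-elements are zero
or a successor. -/
def IsNatIn (D : Set α) (E : α → α → Prop) (x : α) : Prop :=
  IsOrdIn D E x ∧ ∀ y ∈ D, (E y x ∨ y = x) →
    ((∀ z ∈ D, ¬ E z y) ∨ ∃ z ∈ D, E z y ∧ ∀ w ∈ D, (E w y ↔ (E w z ∨ w = z)))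

/-- The class `Ord` of internal ordinals. -/
def ordsOf (D : Set α) (E : α → α → Prop) : Set α := {x | IsOrdIn D E x}

/-- The class `ω` of internal natural numbers. -/
def natsOf (D : Set α) (E : α → α → Prop) : Set α := {x | IsNatIn D E x}

/-- `ETR_ω`: elementary transfinite recursion along the well-order `ω`. -/
def ETRomega (D : Set α) (E : α → α → Prop) (𝒳 : Set (Set α)) : Prop :=
  ETRFor D E 𝒳 (natsOf D E) E

/-- `ETR_Ord`: elementary transfinite recursion along the well-order `Ord`. -/
def ETROrd (D : Set α) (E : α → α → Prop) (𝒳 : Set (Set α)) : Prop :=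
  ETRFor D E 𝒳 (ordsOf D E) E

/-- `lt` is internally a well-order of the class `F`: irreflexive, transitive, total,
and every nonempty set of elements of `F` has an `lt`-minimal element. -/
def IntWORel (D : Set α) (E : α → α → Prop) (F : Set α) (lt : α → α → Prop) : Prop :=
  (∀ a ∈ F, ¬ lt a a) ∧
  (∀ a ∈ F, ∀ b ∈ F, ∀ c ∈ F, lt a b → lt b c → lt a c) ∧
  (∀ a ∈ F, ∀ b ∈ F, a = b ∨ lt a b ∨ lt b a) ∧
  (∀ d ∈ D, (∃ z ∈ D, E z d) → (∀ z ∈ D, E z d → z ∈ F) →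
    ∃ m ∈ D, E m d ∧ ∀ z ∈ D, E z d → ¬ lt z m)

/-- `W ∈ 𝒳`-style class well-order: a class relation which is internally a well-order
of its field. -/
def IsClassWO (D : Set α) (E : α → α → Prop) (W : Set α) : Prop :=
  IsClassRel D E W ∧ IntWORel D E (relFld D E W) (PairIn D E W)

/-- Strict lexicographic order on `Fin n → ℕ`, most significant coordinate first;
the order type of `(Fin n → ℕ, lex)` is `ω^n`. -/
def FinLexLt {n : ℕ} (v w : Fin n → ℕ) : Prop :=
  ∃ i : Fin n, (∀ j : Fin n, j < i → v j = w j) ∧ v i < w i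

/-- The well-order `(F, lt)` has order type at least `ω^ω`: for each `n` there is an
order embedding of `ω^n` into it. -/
def GeOmegaPowOmega (F : Set α) (lt : α → α → Prop) : Prop :=
  ∀ n : ℕ, ∃ f : (Fin n → ℕ) → α, (∀ v, f v ∈ F) ∧
    ∀ v w, FinLexLt v w → lt (f v) (f w)

/-- The field of the well-order `Γ · ω` (`ω` copies of `Γ`, for `Γ` with field `F`):
internal pairs `⟨n, g⟩` with `n` an internal natural number and `g ∈ F`. -/
def timesOmegaFld (D : Set α) (E : α → α → Prop) (F : Set α) : Set α :=
  {p | ∃ n g, IsNatIn D E n ∧ g ∈ F ∧ IsKPair D E p n g}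

/-- The ordering of `Γ · ω`: pairs `⟨n, g⟩` ordered lexicographically with the
natural-number coordinate most significant. -/
def timesOmegaLt (D : Set α) (E : α → α → Prop) (F : Set α)
    (lt : α → α → Prop) : α → α → Prop :=
  fun p q => ∃ n g m h, IsKPair D E p n g ∧ IsKPair D E q m h ∧
    IsNatIn D E n ∧ IsNatIn D E m ∧ g ∈ F ∧ h ∈ F ∧
    (E n m ∨ (n = m ∧ lt g h))

/-- The classes of `(D, E)` definable by pure first-order formulas with set parameters:
`Def(M)`. -/
def Def0 (D : Set α) (E : α → α → Prop) : Set (Set α) :=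
  {X | ∃ φ : Fml, φ.IsPure ∧ ∃ s : ℕ → α, (∀ n, s n ∈ D) ∧
    X = {x | x ∈ D ∧ Sat D E ∅ φ (Function.update s 0 x) (fun _ => (∅ : Set α))}}

/-- The classes of `(D, E)` definable by elementary formulas with set parameters and the
class parameter `A`: `Def(M; A)`. -/
def DefFrom (D : Set α) (E : α → α → Prop) (A : Set α) : Set (Set α) :=
  {X | ∃ φ : Fml, φ.IsElementary ∧ ∃ s : ℕ → α, (∀ n, s n ∈ D) ∧
    X = {x | x ∈ D ∧ Sat D E {A} φ (Function.update s 0 x) (fun _ => A)}}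

/-- `W` is a global well-order of the model: a class strict linear order of `D` which is
set-like and under which every nonempty set has a least element. -/
def IsGWO (D : Set α) (E : α → α → Prop) (W : Set α) : Prop :=
  IsClassRel D E W ∧
  (∀ a ∈ D, ¬ PairIn D E W a a) ∧
  (∀ a ∈ D, ∀ b ∈ D, ∀ c ∈ D, PairIn D E W a b → PairIn D E W b c → PairIn D E W a c) ∧
  (∀ a ∈ D, ∀ b ∈ D, a = b ∨ PairIn D E W a b ∨ PairIn D E W b a) ∧
  (∀ d ∈ D, (∃ z ∈ D, E z d) →
    ∃ m ∈ D, E m d ∧ ∀ z ∈ D, E z d → ¬ PairIn D E W z m) ∧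
  (∀ a ∈ D, ∃ d ∈ D, ∀ b ∈ D, PairIn D E W b a → E b d)

/-- `(M, 𝒳)` is a transitive model of `GB`: `M` is a transitive set, the membership
relation is the true `∈`, and the classes `𝒳` are subsets of `M`. -/
def TransGB (M : ZFSet) (𝒳 : Set (Set ZFSet)) : Prop :=
  M.IsTransitive ∧ GBModel M.toSet (· ∈ ·) 𝒳

/-- A class relation `R` on a transitive model is *truly* well-founded when the
corresponding external relation is well-founded. -/
def TrulyWF (M : ZFSet) (R : Set ZFSet) : Prop :=
  WellFounded (fun a b : ZFSet => PairIn M.toSet (· ∈ ·) R a b)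

/-- `(M, 𝒳)` is a β-model: every class relation in `𝒳` which the model believes to be
well-founded is truly well-founded. -/
def IsBeta (M : ZFSet) (𝒳 : Set (Set ZFSet)) : Prop :=
  ∀ R ∈ 𝒳, IsClassRel M.toSet (· ∈ ·) R → IntWF M.toSet (· ∈ ·) R → TrulyWF M R

end SOST

namespace SOST

/-- A Gödel code for formulas. -/
def Fml.code : Fml → ℕ
  | .memSS i j => Nat.pair 0 (Nat.pair i j)
  | .memSC i j => Nat.pair 1 (Nat.pair i j)
  | .eqS i j => Nat.pair 2 (Nat.pair i j)
  | .fal => Nat.pair 3 0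
  | .imp φ ψ => Nat.pair 4 (Nat.pair φ.code ψ.code)
  | .allS i φ => Nat.pair 5 (Nat.pair i φ.code)
  | .allC i φ => Nat.pair 6 (Nat.pair i φ.code)

/-- Satisfaction for a second-order theory given as a set `T ⊆ ω` of codes of
(two-sorted) formulas: every coded formula holds under all assignments into the model. -/
def SatSOTheory (D : Set α) (E : α → α → Prop) (𝒳 : Set (Set α)) (T : Set ℕ) : Prop :=
  ∀ φ : Fml, φ.code ∈ T → ∀ s : ℕ → α, (∀ n, s n ∈ D) →
    ∀ c : ℕ → Set α, (∀ n, c n ∈ 𝒳) → Sat D E 𝒳 φ s c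

/-- Satisfaction for a first-order theory given as a set of pure formulas. -/
def SatTheory (D : Set α) (E : α → α → Prop) (T : Set Fml) : Prop :=
  ∀ φ ∈ T, ∀ s : ℕ → α, (∀ n, s n ∈ D) →
    Sat D E ∅ φ s (fun _ => (∅ : Set α))

/-- The internal von Neumann numeral for `k`. -/
def Numeral (D : Set α) (E : α → α → Prop) : ℕ → α → Prop
  | 0, x => x ∈ D ∧ ∀ z ∈ D, ¬ E z x
  | (n + 1), x => x ∈ D ∧ ∃ y ∈ D, Numeral D E n y ∧ ∀ z ∈ D, (E z x ↔ (E z y ∨ z = y))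

/-- The external von Neumann numeral, as a `ZFSet`. -/
def zfNumeral : ℕ → ZFSet
  | 0 => ∅
  | (n + 1) => insert (zfNumeral n) (zfNumeral n)

/-- The real coded by a set `T ⊆ ω` of natural numbers, as a `ZFSet`. -/
def zfCode (T : Set ℕ) : ZFSet :=
  ZFSet.sep (fun z => ∃ k ∈ T, z = zfNumeral k) ZFSet.omega

instance : WellFoundedRelation ZFSet := ⟨_, ZFSet.mem_wf⟩

/-- The subsets of the transitive set `P` (given as a `Set ZFSet`) which are definable
over the structure `(P, ∈)` by a pure first-order formula with parameters from `P`. -/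
def DefSetsOver (P : Set ZFSet) : Set ZFSet :=
  {X | ∃ φ : Fml, φ.IsPure ∧ ∃ s : ℕ → ZFSet, (∀ n, s n ∈ P) ∧
    ∀ z : ZFSet, z ∈ X ↔
      (z ∈ P ∧ Sat P (· ∈ ·) ∅ φ (Function.update s 0 z) (fun _ => (∅ : Set ZFSet)))}

/-- `a` is a genuine von Neumann ordinal (a transitive set of transitive sets). -/
def IsVonNeumann (a : ZFSet) : Prop :=
  a.IsTransitive ∧ ∀ b ∈ a.toSet, b.IsTransitive

/-- The stage `L_a` of the constructible hierarchy, indexed by von Neumann ordinals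
(each stage consists of the subsets definable over the union of the earlier stages). -/
noncomputable def LStage (a : ZFSet) : Set ZFSet :=
  DefSetsOver (⋃ b : {b : ZFSet // b ∈ a}, LStage b.1)
termination_by a
decreasing_by exact b.2

/-- The constructible universe computed inside the transitive set `M`:
the union of the stages `L_α` for `α` an ordinal of `M`. -/
def ConstructibleOf (M : ZFSet) : Set ZFSet :=
  ⋃ a ∈ {a : ZFSet | a ∈ M ∧ IsVonNeumann a}, LStage a

/-- `L^M`, as a transitive subset of `M` (a `ZFSet`). -/
noncomputable def LM (M : ZFSet) : ZFSet :=
  ZFSet.sep (fun x => x ∈ ConstructibleOf M) M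

/-- The collection of all subclasses of (the transitive set) `N` which are amenable
to `N`: `X ∩ a ∈ N` for every `a ∈ N`. -/
def AmenablesOf (N : ZFSet) : Set (Set ZFSet) :=
  {X | X ⊆ N.toSet ∧ ∀ a ∈ N.toSet, ZFSet.sep (fun z => z ∈ X) a ∈ N.toSet}

/-- The binary class relation named by the parameter-free pure formula `θ` (with free
set variables `0` and `1`), evaluated in the model `(D, E)`. -/
def NameRel (θ : Fml) (D : Set α) (E : α → α → Prop) (x y : α) : Prop :=
  x ∈ D ∧ y ∈ D ∧ ∀ s : ℕ → α, (∀ n, s n ∈ D) →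
    Sat D E ∅ θ (Function.update (Function.update s 0 x) 1 y) (fun _ => (∅ : Set α))

/-- The field of the class relation named by `θ` in the model `(D, E)`. -/
def NameFld (θ : Fml) (D : Set α) (E : α → α → Prop) : Set α :=
  {x | ∃ y, NameRel θ D E x y ∨ NameRel θ D E y x}

/-- The set named by the parameter-free pure formula `θ` (with free set variable `0`),
evaluated in the model `(D, E)`. -/
def NameSet (θ : Fml) (D : Set α) (E : α → α → Prop) (x : α) : Prop :=
  x ∈ D ∧ ∀ s : ℕ → α, (∀ n, s n ∈ D) →
    Sat D E ∅ θ (Function.update s 0 x) (fun _ => (∅ : Set α))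

/-- `𝒴` is coded in the model by the single class `C`: the members of `𝒴` are exactly
the classes definable (by elementary formulas, with set parameters) from finitely many
slices of `C`. -/
def CodedBy (D : Set α) (E : α → α → Prop) (C : Set α) (𝒴 : Set (Set α)) : Prop :=
  ∀ X : Set α, X ∈ 𝒴 ↔
    ∃ φ : Fml, φ.IsElementary ∧ ∃ s : ℕ → α, (∀ n, s n ∈ D) ∧
      ∃ g : ℕ → α, (∀ n, g n ∈ D) ∧
      X = {x | x ∈ D ∧ Sat D E 𝒴 φ (Function.update s 0 x)
        (fun n => slice D E C (g n))}

end SOST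

namespace SOST

/-- Δ₀ (bounded) formulas of the first-order language of set theory: all quantifiers
appear in the bounded pattern `∀ xᵢ (xᵢ ∈ xⱼ → …)`. -/
def Fml.IsDelta0 : Fml → Prop
  | .memSS _ _ => True
  | .memSC _ _ => False
  | .eqS _ _ => True
  | .fal => True
  | .imp φ ψ => φ.IsDelta0 ∧ ψ.IsDelta0
  | .allS i (.imp (.memSS i' j) φ) => i = i' ∧ i ≠ j ∧ φ.IsDelta0
  | .allS _ _ => False
  | .allC _ _ => False

/-- Π₁ formulas: a block of universal set quantifiers followed by a Δ₀ formula. -/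
def Fml.IsPi1 : Fml → Prop
  | .allS _ φ => φ.IsPi1
  | φ => φ.IsDelta0

/-- Kripke–Platek set theory `KP` over the structure with domain `D` and membership `E`:
Extensionality, Pairing, Union, Δ₀-Separation, Δ₀-Collection, and Π₁-Foundation. -/
structure KPModel (D : Set α) (E : α → α → Prop) : Prop where
  exten : ∀ x ∈ D, ∀ y ∈ D, (∀ z ∈ D, E z x ↔ E z y) → x = y
  pairing : ∀ x ∈ D, ∀ y ∈ D, ∃ p ∈ D, ∀ z ∈ D, E z p ↔ (z = x ∨ z = y)
  union : ∀ x ∈ D, ∃ u ∈ D, ∀ z ∈ D, E z u ↔ ∃ w ∈ D, E w x ∧ E z w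
  delta0Sep : ∀ φ : Fml, φ.IsDelta0 → ∀ s : ℕ → α, (∀ n, s n ∈ D) → ∀ a ∈ D,
    ∃ b ∈ D, ∀ z ∈ D, E z b ↔
      (E z a ∧ Sat D E ∅ φ (Function.update s 0 z) (fun _ => (∅ : Set α)))
  delta0Coll : ∀ φ : Fml, φ.IsDelta0 → ∀ s : ℕ → α, (∀ n, s n ∈ D) → ∀ a ∈ D,
    (∀ x ∈ D, E x a → ∃ y ∈ D,
      Sat D E ∅ φ (Function.update (Function.update s 0 x) 1 y) (fun _ => (∅ : Set α))) →
    ∃ b ∈ D, ∀ x ∈ D, E x a → ∃ y ∈ D, E y b ∧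
      Sat D E ∅ φ (Function.update (Function.update s 0 x) 1 y) (fun _ => (∅ : Set α))
  pi1Foundation : ∀ φ : Fml, φ.IsPi1 → ∀ s : ℕ → α, (∀ n, s n ∈ D) →
    (∃ x ∈ D, Sat D E ∅ φ (Function.update s 0 x) (fun _ => (∅ : Set α))) →
    ∃ x ∈ D, Sat D E ∅ φ (Function.update s 0 x) (fun _ => (∅ : Set α)) ∧
      ∀ y ∈ D, E y x → ¬ Sat D E ∅ φ (Function.update s 0 y) (fun _ => (∅ : Set α))

/-- `m` is the maximum element of the class relation `N`: every other element of the
field lies below `m` in the transitive closure of `N`. -/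
def IsMaxOf (D : Set α) (E : α → α → Prop) (N : Set α) (m : α) : Prop :=
  m ∈ relFld D E N ∧
    ∀ a ∈ relFld D E N, a ≠ m → Relation.TransGen (PairIn D E N) a m

/-- A *membership code*: a well-founded (in the sense of the model), extensional class
binary relation with a maximum element. -/
def IsMemCode (D : Set α) (E : α → α → Prop) (N : Set α) : Prop :=
  IsClassRel D E N ∧ IntWF D E N ∧
    (∀ a ∈ relFld D E N, ∀ b ∈ relFld D E N,
      (∀ c, PairIn D E N c a ↔ PairIn D E N c b) → a = b) ∧
    ∃ m, IsMaxOf D E N m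

/-- The membership code `(N, m)` codes a transitive set: predecessors of predecessors
of the maximum element are predecessors of the maximum element. -/
def CodesTransitiveSet (D : Set α) (E : α → α → Prop) (N : Set α) (m : α) : Prop :=
  ∀ a b, PairIn D E N a b → PairIn D E N b m → PairIn D E N a m

/-- The set coded by `(N, m)` contains (an isomorphic copy of) the class `V` of all
sets as an element: there are `v` below `m` and a class isomorphism `I ∈ 𝒳` between
`(D, E)` and the predecessors of `v` in `N`. -/
def ContainsUniverse (D : Set α) (E : α → α → Prop) (𝒳 : Set (Set α))
    (N : Set α) (m : α) : Prop :=
  ∃ v, PairIn D E N v m ∧ ∃ I ∈ 𝒳,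
    (∀ z ∈ I, ∃ x a, x ∈ D ∧ IsKPair D E z x a) ∧
    (∀ x a a', PairIn D E I x a → PairIn D E I x a' → a = a') ∧
    (∀ x x' a, PairIn D E I x a → PairIn D E I x' a → x = x') ∧
    (∀ x ∈ D, ∃ a, PairIn D E I x a ∧ PairIn D E N a v) ∧
    (∀ a, PairIn D E N a v → ∃ x ∈ D, PairIn D E I x a) ∧
    (∀ x y a b, PairIn D E I x a → PairIn D E I y b → (E x y ↔ PairIn D E N a b))

/-- `N` is a membership code for (a transitive model of) `Hyp(V)`-style structure:
it codes a transitive model of `KP` containing the universe as an element. -/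
def IsHypVCode (D : Set α) (E : α → α → Prop) (𝒳 : Set (Set α)) (N : Set α) : Prop :=
  IsMemCode D E N ∧ ∃ m, IsMaxOf D E N m ∧ CodesTransitiveSet D E N m ∧
    KPModel {a | PairIn D E N a m} (PairIn D E N) ∧
    ContainsUniverse D E 𝒳 N m

/-- `J` is (the graph of) an isomorphism of the membership code `N₀` onto an initial
(downward closed) part of the membership code `N`. -/
def InitEmbed (D : Set α) (E : α → α → Prop) (N₀ N J : Set α) : Prop :=
  (∀ z ∈ J, ∃ a b, IsKPair D E z a b) ∧
  (∀ a b b', PairIn D E J a b → PairIn D E J a b' → b = b') ∧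
  (∀ a a' b, PairIn D E J a b → PairIn D E J a' b → a = a') ∧
  (∀ a b, PairIn D E J a b → a ∈ relFld D E N₀ ∧ b ∈ relFld D E N) ∧
  (∀ a ∈ relFld D E N₀, ∃ b, PairIn D E J a b) ∧
  (∀ a a' b b', PairIn D E J a b → PairIn D E J a' b' →
    (PairIn D E N₀ a a' ↔ PairIn D E N b b')) ∧
  (∀ a b c, PairIn D E J a b → PairIn D E N c b →
    ∃ a', PairIn D E N₀ a' a ∧ PairIn D E J a' c)

/-! ### Kripke–Platek set theory with urelements, and `Hyp(M)` -/

/-- Formulas of the language of `KPU` over a structure `M`: membership `mem`, equality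
`eq`, the urelement predicate `urel`, and the membership relation `memU` of `M` on the
urelements. -/
inductive UFml : Type
  | mem : ℕ → ℕ → UFml
  | eq : ℕ → ℕ → UFml
  | urel : ℕ → UFml
  | memU : ℕ → ℕ → UFml
  | fal : UFml
  | imp : UFml → UFml → UFml
  | all : ℕ → UFml → UFml

variable {β : Type*}

/-- Satisfaction for `UFml` in a structure `(β, u, Eb, EU)`: `u` is the urelement
predicate, `Eb` the set membership and `EU` the membership relation of `M` on the
urelements. -/
def USat (u : β → Prop) (Eb EU : β → β → Prop) : UFml → (ℕ → β) → Prop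
  | .mem i j, s => Eb (s i) (s j)
  | .eq i j, s => s i = s j
  | .urel i, s => u (s i)
  | .memU i j, s => EU (s i) (s j)
  | .fal, _ => False
  | .imp φ ψ, s => USat u Eb EU φ s → USat u Eb EU ψ s
  | .all i φ, s => ∀ x : β, USat u Eb EU φ (Function.update s i x)

/-- Δ₀ formulas of the language of `KPU`. -/
def UFml.IsDelta0 : UFml → Prop
  | .mem _ _ => True
  | .eq _ _ => True
  | .urel _ => True
  | .memU _ _ => True
  | .fal => True
  | .imp φ ψ => φ.IsDelta0 ∧ ψ.IsDelta0
  | .all i (.imp (.mem i' j) φ) => i = i' ∧ i ≠ j ∧ φ.IsDelta0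
  | .all _ _ => False

/-- Kripke–Platek set theory with urelements, `KPU`: extensionality for sets, urelements
have no members, Pairing, Union, Δ₀-Separation, Δ₀-Collection, and the Foundation
schema. -/
structure KPUModel (u : β → Prop) (Eb EU : β → β → Prop) : Prop where
  urelNoMem : ∀ x, u x → ∀ z, ¬ Eb z x
  euUrel : ∀ x y, EU x y → u x ∧ u y
  exten : ∀ x y, ¬ u x → ¬ u y → (∀ z, Eb z x ↔ Eb z y) → x = y
  pairing : ∀ x y, ∃ p, ¬ u p ∧ ∀ z, Eb z p ↔ (z = x ∨ z = y)
  union : ∀ x, ∃ w, ¬ u w ∧ ∀ z, Eb z w ↔ ∃ y, Eb y x ∧ Eb z y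
  delta0Sep : ∀ φ : UFml, φ.IsDelta0 → ∀ s : ℕ → β, ∀ a,
    ∃ b, ¬ u b ∧ ∀ z, Eb z b ↔ (Eb z a ∧ USat u Eb EU φ (Function.update s 0 z))
  delta0Coll : ∀ φ : UFml, φ.IsDelta0 → ∀ s : ℕ → β, ∀ a,
    (∀ x, Eb x a → ∃ y, USat u Eb EU φ (Function.update (Function.update s 0 x) 1 y)) →
    ∃ b, ∀ x, Eb x a → ∃ y, Eb y b ∧
      USat u Eb EU φ (Function.update (Function.update s 0 x) 1 y)
  foundation : ∀ φ : UFml, ∀ s : ℕ → β,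
    (∃ x, USat u Eb EU φ (Function.update s 0 x)) →
    ∃ x, USat u Eb EU φ (Function.update s 0 x) ∧
      ∀ y, Eb y x → ¬ USat u Eb EU φ (Function.update s 0 y)

/-- The structure `(β, u, Eb, EU)` is a model of `KPU` over the first-order model of set
theory `(α, E)`, with the urelements forming an isomorphic copy of `(α, E)` (via `ι`)
and with the set of all urelements (i.e., `M` itself) existing as an element. -/
def IsKPUOver (E : α → α → Prop) (u : β → Prop) (Eb EU : β → β → Prop)
    (ι : α → β) : Prop :=
  KPUModel u Eb EU ∧
  Function.Injective ι ∧
  (∀ x, u (ι x)) ∧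
  (∀ b, u b → ∃ x, b = ι x) ∧
  (∀ x y, EU (ι x) (ι y) ↔ E x y) ∧
  (∃ m, ¬ u m ∧ ∀ z, Eb z m ↔ u z)

/-- `S ⊆ M` is internal to the `KPU` structure: some element `b` has exactly the
urelements corresponding to `S` as its members. -/
def InternalIn (u : β → Prop) (Eb : β → β → Prop) (ι : α → β) (S : Set α) : Prop :=
  ∃ b, ¬ u b ∧ (∀ z, Eb z b → u z) ∧ ∀ x, (Eb (ι x) b ↔ x ∈ S)

/-- `Hyp(M) ∩ 𝒫(M)`: the collection of all `S ⊆ M` which are internal to every model of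
`KPU` over `M` containing `M` as an element. (For countable `M` this is exactly the
collection of subsets of `M` lying in the least admissible set `Hyp(M)` above `M`.) -/
def HypClasses {α : Type} (E : α → α → Prop) : Set (Set α) :=
  {S | ∀ (β : Type) (u : β → Prop) (Eb EU : β → β → Prop) (ι : α → β),
    IsKPUOver E u Eb EU ι → InternalIn u Eb ι S}

end SOST

namespace SOST

variable {α : Type*}

/-- `GBC`: Gödel–Bernays set theory with Global Choice. -/
def GBC (D : Set α) (E : α → α → Prop) (𝒳 : Set (Set α)) : Prop :=
  GBModel D E 𝒳 ∧ GlobalChoice D E 𝒳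

/-- The Class Collection schema: if for every set `x` there is a class `Y` with
`φ(x, Y, P̄)`, then there is a single class `C` such that for every `x` some slice
`(C)_i` witnesses `φ`. -/
def ClassCollection (D : Set α) (E : α → α → Prop) (𝒳 : Set (Set α)) : Prop :=
  ∀ φ : Fml, ∀ s : ℕ → α, (∀ n, s n ∈ D) → ∀ c : ℕ → Set α, (∀ n, c n ∈ 𝒳) →
    (∀ x ∈ D, ∃ Y ∈ 𝒳,
      Sat D E 𝒳 φ (Function.update s 0 x) (Function.update c 0 Y)) →
    ∃ C ∈ 𝒳, ∀ x ∈ D, ∃ i ∈ D,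
      Sat D E 𝒳 φ (Function.update s 0 x) (Function.update c 0 (slice D E C i))

/-- The Class Choice schema: as Class Collection, but the witnessing slice for `x`
is `(C)_x` itself. -/
def ClassChoice (D : Set α) (E : α → α → Prop) (𝒳 : Set (Set α)) : Prop :=
  ∀ φ : Fml, ∀ s : ℕ → α, (∀ n, s n ∈ D) → ∀ c : ℕ → Set α, (∀ n, c n ∈ 𝒳) →
    (∀ x ∈ D, ∃ Y ∈ 𝒳,
      Sat D E 𝒳 φ (Function.update s 0 x) (Function.update c 0 Y)) →
    ∃ C ∈ 𝒳, ∀ x ∈ D,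
      Sat D E 𝒳 φ (Function.update s 0 x) (Function.update c 0 (slice D E C x))

/-- `x` is internally the empty set (the numeral `0`). -/
def IsZeroIn (D : Set α) (E : α → α → Prop) (x : α) : Prop :=
  x ∈ D ∧ ∀ z ∈ D, ¬ E z x

/-- `x` is internally the numeral `1 = {0}`. -/
def IsOneIn (D : Set α) (E : α → α → Prop) (x : α) : Prop :=
  x ∈ D ∧ ∀ z ∈ D, (E z x ↔ IsZeroIn D E z)

/-- The pair `⟨a, b⟩` is an element of the *set* `p`. -/
def pairInSet (D : Set α) (E : α → α → Prop) (p a b : α) : Prop :=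
  ∃ z ∈ D, E z p ∧ IsKPair D E z a b

/-- `p` is a condition of the class forcing to add a Cohen subclass of `Ord`:
a set-sized binary sequence, i.e. an internal function from some ordinal to `2`. -/
def IsCond (D : Set α) (E : α → α → Prop) (p : α) : Prop :=
  p ∈ D ∧ ∃ γ, IsOrdIn D E γ ∧
    (∀ z ∈ D, E z p → ∃ ξ v, E ξ γ ∧ (IsZeroIn D E v ∨ IsOneIn D E v) ∧
      IsKPair D E z ξ v) ∧
    (∀ ξ ∈ D, E ξ γ → ∃ v, pairInSet D E p ξ v) ∧
    (∀ ξ v v', pairInSet D E p ξ v → pairInSet D E p ξ v' → v = v')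

/-- `q` extends the condition `p` (is a stronger condition). -/
def CondExtends (D : Set α) (E : α → α → Prop) (q p : α) : Prop :=
  ∀ ξ v, pairInSet D E p ξ v → pairInSet D E q ξ v

/-- The condition `p` agrees with the class `C ⊆ Ord` (is an initial segment of its
characteristic function). -/
def AgreesWith (D : Set α) (E : α → α → Prop) (C : Set α) (p : α) : Prop :=
  ∀ ξ v, pairInSet D E p ξ v → ((ξ ∈ C) ↔ IsOneIn D E v)

/-- `C ⊆ Ord` is a Cohen-generic class over the model: it is a class of ordinals
decided below every ordinal by a condition, and it meets every dense class of
conditions definable over the model from set parameters. -/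
def CohenGeneric (D : Set α) (E : α → α → Prop) (C : Set α) : Prop :=
  (∀ x ∈ C, IsOrdIn D E x) ∧
  (∀ γ, IsOrdIn D E γ → ∃ p, IsCond D E p ∧ AgreesWith D E C p ∧
    ∀ ξ ∈ D, E ξ γ → ∃ v, pairInSet D E p ξ v) ∧
  (∀ Δ ∈ Def0 D E, (∀ z ∈ Δ, IsCond D E z) →
    (∀ p, IsCond D E p → ∃ q ∈ Δ, CondExtends D E q p) →
    ∃ p ∈ Δ, AgreesWith D E C p)

/-- `𝒳` is a β-`(GB + ETR)`-realization for the transitive set `M`. -/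
def BetaETRReal (M : ZFSet) (𝒳 : Set (Set ZFSet)) : Prop :=
  GBModel M.toSet (· ∈ ·) 𝒳 ∧ ETR M.toSet (· ∈ ·) 𝒳 ∧ IsBeta M 𝒳

/-- `(D, E, 𝒳)` is (isomorphic to) a β-model: the membership relation is well-founded
and extensional (so the model is isomorphic to a transitive one), and every class
relation in `𝒳` believed to be well-founded is truly well-founded. -/
def BetaReal (D : Set α) (E : α → α → Prop) (𝒳 : Set (Set α)) : Prop :=
  WellFounded (fun x y => x ∈ D ∧ y ∈ D ∧ E x y) ∧
  (∀ x ∈ D, ∀ y ∈ D, (∀ z ∈ D, E z x ↔ E z y) → x = y) ∧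
  ∀ R ∈ 𝒳, IsClassRel D E R → IntWF D E R →
    WellFounded (fun a b => PairIn D E R a b)

end SOST


namespace SOST

set_option linter.unusedSectionVars false

section

/-- Terms over a structure with a name for each element: de Bruijn variables and constants. -/
inductive DTm (α : Type*) : Type _
  | var : ℕ → DTm α
  | cst : α → DTm α

/-- First-order formulas with constants and one unary predicate, in de Bruijn style. -/
inductive DFm (α : Type*) : Type _
  | mem : DTm α → DTm α → DFm α
  | cls : DTm α → DFm α
  | eq : DTm α → DTm α → DFm α
  | fal : DFm α
  | imp : DFm α → DFm α → DFm α
  | all : DFm α → DFm α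

variable {α : Type*}

instance [Countable α] : Countable (DTm α) := by
  refine Function.Surjective.countable (f := Sum.elim (DTm.var (α := α)) DTm.cst) ?_
  rintro (n | c)
  exacts [⟨.inl n, rfl⟩, ⟨.inr c, rfl⟩]

/-- Gödel numbering of formulas induced by a numbering of terms. -/
def DFm.code (f : DTm α → ℕ) : DFm α → ℕ
  | .mem a b => Nat.pair 0 (Nat.pair (f a) (f b))
  | .cls a => Nat.pair 1 (f a)
  | .eq a b => Nat.pair 2 (Nat.pair (f a) (f b))
  | .fal => Nat.pair 3 0
  | .imp φ ψ => Nat.pair 4 (Nat.pair (φ.code f) (ψ.code f))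
  | .all φ => Nat.pair 5 (φ.code f)

theorem DFm.code_injective {f : DTm α → ℕ} (hf : Function.Injective f) :
    Function.Injective (DFm.code f) := by
  intro φ
  induction φ with
  | imp φ₁ φ₂ ih₁ ih₂ =>
    intro ψ h
    cases ψ <;> simp only [DFm.code, Nat.pair_eq_pair] at h <;> try simp at h
    rw [ih₁ h.1, ih₂ h.2]
  | all φ ih =>
    intro ψ h
    cases ψ <;> simp only [DFm.code, Nat.pair_eq_pair] at h <;> try simp at h
    rw [ih h]
  | _ =>
    intro ψ h
    cases ψ <;> simp_all [DFm.code, Nat.pair_eq_pair, hf.eq_iff]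

instance [Countable α] : Countable (DFm α) := by
  obtain ⟨f, hf⟩ := exists_injective_nat (DTm α)
  exact (DFm.code_injective hf).countable

/-- Prepend a value to a stream of values. -/
def scons (x : α) (t : ℕ → α) : ℕ → α
  | 0 => x
  | n + 1 => t n

/-- Value of a term under a stream of values for the variables. -/
def DTm.eval : DTm α → (ℕ → α) → α
  | .var n, t => t n
  | .cst a, _ => a

/-- Weakening of a term by one variable. -/
def DTm.up : DTm α → DTm α
  | .var n => .var (n + 1)
  | .cst a => .cst a

/-- Simultaneous substitution in a term. -/
def DTm.subst (σ : ℕ → DTm α) : DTm α → DTm α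
  | .var n => σ n
  | .cst a => .cst a

/-- Lift of a substitution under a binder. -/
def liftSubst (σ : ℕ → DTm α) : ℕ → DTm α
  | 0 => .var 0
  | n + 1 => (σ n).up

/-- Simultaneous substitution in a formula. -/
def DFm.subst : (ℕ → DTm α) → DFm α → DFm α
  | σ, .mem a b => .mem (a.subst σ) (b.subst σ)
  | σ, .cls a => .cls (a.subst σ)
  | σ, .eq a b => .eq (a.subst σ) (b.subst σ)
  | _, .fal => .fal
  | σ, .imp φ ψ => .imp (φ.subst σ) (ψ.subst σ)
  | σ, .all φ => .all (φ.subst (liftSubst σ))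

/-- Satisfaction for `DFm` in the structure `(α, E, A)`. -/
def DFm.eval (E : α → α → Prop) (A : Set α) : DFm α → (ℕ → α) → Prop
  | .mem a b, t => E (a.eval t) (b.eval t)
  | .cls a, t => a.eval t ∈ A
  | .eq a b, t => a.eval t = b.eval t
  | .fal, _ => False
  | .imp φ ψ, t => φ.eval E A t → ψ.eval E A t
  | .all φ, t => ∀ x, φ.eval E A (scons x t)

theorem DTm.eval_subst (σ : ℕ → DTm α) (a : DTm α) (t : ℕ → α) :
    (a.subst σ).eval t = a.eval fun n => (σ n).eval t := by
  cases a <;> rfl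

theorem liftSubst_eval (σ : ℕ → DTm α) (x : α) (t : ℕ → α) :
    (fun n => (liftSubst σ n).eval (scons x t)) = scons x fun n => (σ n).eval t := by
  funext n
  cases n with
  | zero => rfl
  | succ n => simp only [liftSubst, scons]; cases σ n <;> rfl

theorem DFm.eval_subst (E : α → α → Prop) (A : Set α) (φ : DFm α) :
    ∀ (σ : ℕ → DTm α) (t : ℕ → α),
      (φ.subst σ).eval E A t ↔ φ.eval E A fun n => (σ n).eval t := by
  induction φ with
  | mem a b => intro σ t; simp only [DFm.subst, DFm.eval, DTm.eval_subst]
  | cls a => intro σ t; simp only [DFm.subst, DFm.eval, DTm.eval_subst]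
  | eq a b => intro σ t; simp only [DFm.subst, DFm.eval, DTm.eval_subst]
  | fal => intro σ t; rfl
  | imp φ ψ ih₁ ih₂ => intro σ t; simp only [DFm.subst, DFm.eval, ih₁, ih₂]
  | all φ ih => intro σ t; simp only [DFm.subst, DFm.eval, ih, liftSubst_eval]

/-- A predicate of streams is definable over `(α, E, A)` with parameters. -/
class Dfn (E : α → α → Prop) (A : Set α) (P : (ℕ → α) → Prop) : Prop where
  out : ∃ φ : DFm α, ∀ t, P t ↔ φ.eval E A t

/-- A function of streams is definable over `(α, E, A)` if its graph is. -/
class DfnT (E : α → α → Prop) (A : Set α) (f : (ℕ → α) → α) : Prop where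
  out : Dfn E A fun t => t 0 = f fun n => t (n + 1)

/-- Definable unary predicates. -/
class Def1 (E : α → α → Prop) (A : Set α) (P : α → Prop) : Prop where
  out : Dfn E A fun t => P (t 0)

/-- Definable binary predicates. -/
class Def2 (E : α → α → Prop) (A : Set α) (R : α → α → Prop) : Prop where
  out : Dfn E A fun t => R (t 0) (t 1)

/-- Definable ternary predicates. -/
class Def3 (E : α → α → Prop) (A : Set α) (R : α → α → α → Prop) : Prop where
  out : Dfn E A fun t => R (t 0) (t 1) (t 2)

/-- Definable unary functions. -/
class DefF1 (E : α → α → Prop) (A : Set α) (F : α → α) : Prop where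
  out : DfnT E A fun t => F (t 0)

/-- Definable binary functions. -/
class DefF2 (E : α → α → Prop) (A : Set α) (F : α → α → α) : Prop where
  out : DfnT E A fun t => F (t 0) (t 1)

section Closure

variable {E : α → α → Prop} {A : Set α}

theorem Dfn.of_iff {P Q : (ℕ → α) → Prop} (hP : Dfn E A P) (h : ∀ t, Q t ↔ P t) : Dfn E A Q :=
  ⟨hP.out.imp fun _ hφ t => (h t).trans (hφ t)⟩

theorem Dfn.subst {P : (ℕ → α) → Prop} (hP : Dfn E A P) (σ : ℕ → DTm α) :
    Dfn E A fun t => P fun n => (σ n).eval t := by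
  obtain ⟨φ, hφ⟩ := hP.out
  exact ⟨φ.subst σ, fun t => (hφ _).trans (φ.eval_subst E A σ t).symm⟩

theorem Dfn.rename {P : (ℕ → α) → Prop} (hP : Dfn E A P) (f : ℕ → ℕ) :
    Dfn E A fun t => P fun n => t (f n) :=
  hP.subst fun n => .var (f n)

instance Dfn.const (p : Prop) : Dfn E A fun _ => p := by
  by_cases hp : p
  · exact ⟨.imp .fal .fal, fun t => by simp [DFm.eval, hp]⟩
  · exact ⟨.fal, fun t => by simp [DFm.eval, hp]⟩

instance Dfn.imp {P Q : (ℕ → α) → Prop} [hP : Dfn E A P] [hQ : Dfn E A Q] :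
    Dfn E A fun t => P t → Q t := by
  obtain ⟨φ, hφ⟩ := hP.out
  obtain ⟨ψ, hψ⟩ := hQ.out
  exact ⟨.imp φ ψ, fun t => by simp only [hφ, hψ, DFm.eval]⟩

instance Dfn.all {P : (ℕ → α) → α → Prop} [h : Dfn E A fun t => P (fun n => t (n + 1)) (t 0)] :
    Dfn E A fun t => ∀ x, P t x := by
  obtain ⟨φ, hφ⟩ := h.out
  exact ⟨.all φ, fun t => forall_congr' fun x => hφ (scons x t)⟩

instance Dfn.not {P : (ℕ → α) → Prop} [hP : Dfn E A P] : Dfn E A fun t => ¬ P t :=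
  Dfn.imp (Q := fun _ => False)

instance Dfn.and {P Q : (ℕ → α) → Prop} [hP : Dfn E A P] [hQ : Dfn E A Q] :
    Dfn E A fun t => P t ∧ Q t :=
  (inferInstance : Dfn E A fun t => ¬ (P t → ¬ Q t)).of_iff fun t => by tauto

instance Dfn.or {P Q : (ℕ → α) → Prop} [hP : Dfn E A P] [hQ : Dfn E A Q] :
    Dfn E A fun t => P t ∨ Q t :=
  (inferInstance : Dfn E A fun t => ¬ P t → Q t).of_iff fun t => by tauto

instance Dfn.iff {P Q : (ℕ → α) → Prop} [hP : Dfn E A P] [hQ : Dfn E A Q] :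
    Dfn E A fun t => (P t ↔ Q t) :=
  (inferInstance : Dfn E A fun t => (P t → Q t) ∧ (Q t → P t)).of_iff fun t => by tauto

instance Dfn.ex {P : (ℕ → α) → α → Prop} [h : Dfn E A fun t => P (fun n => t (n + 1)) (t 0)] :
    Dfn E A fun t => ∃ x, P t x :=
  (inferInstance : Dfn E A fun t => ¬ ∀ x, ¬ P t x).of_iff fun t => by simp

instance DfnT.var (n : ℕ) : DfnT E A fun t => t n :=
  ⟨⟨.eq (.var 0) (.var (n + 1)), fun _ => Iff.rfl⟩⟩

instance DfnT.const (c : α) : DfnT E A fun _ => c :=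
  ⟨⟨.eq (.var 0) (.cst c), fun _ => Iff.rfl⟩⟩

theorem DfnT.rename {f : (ℕ → α) → α} (hf : DfnT E A f) (g : ℕ → ℕ) :
    DfnT E A fun t => f fun n => t (g n) :=
  ⟨(hf.out.rename fun n => Nat.casesOn n 0 fun k => g k + 1).of_iff fun _ => Iff.rfl⟩

theorem Dfn.letE {P : (ℕ → α) → Prop} {f : (ℕ → α) → α} (hP : Dfn E A P) (hf : DfnT E A f) :
    Dfn E A fun t => P (scons (f t) t) := by
  have := hf.out
  have hP' : Dfn E A fun t => P (scons (t 0) fun n => t (n + 1)) :=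
    hP.of_iff fun t => by
      have : scons (t 0) (fun n => t (n + 1)) = t := by funext n; cases n <;> rfl
      rw [this]
  exact (inferInstance : Dfn E A fun t => ∃ x, x = f t ∧ P (scons x t)).of_iff fun t => by simp

instance Def1.app {P : α → Prop} {f : (ℕ → α) → α} [hP : Def1 E A P] [hf : DfnT E A f] :
    Dfn E A fun t => P (f t) :=
  hP.out.letE hf

instance Def2.app {R : α → α → Prop} {f g : (ℕ → α) → α} [hR : Def2 E A R]
    [hf : DfnT E A f] [hg : DfnT E A g] : Dfn E A fun t => R (f t) (g t) :=
  ((hR.out.rename fun n => if n = 0 then 1 else 0).letE (hg.rename (· + 1))).letE hf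

instance Def3.app {R : α → α → α → Prop} {f g h : (ℕ → α) → α} [hR : Def3 E A R]
    [hf : DfnT E A f] [hg : DfnT E A g] [hh : DfnT E A h] :
    Dfn E A fun t => R (f t) (g t) (h t) :=
  (((hR.out.rename fun n => if n = 0 then 2 else if n = 1 then 1 else 0).letE
    (hh.rename (· + 2))).letE (hg.rename (· + 1))).letE hf

instance Def2.mem : Def2 E A E := ⟨⟨.mem (.var 0) (.var 1), fun _ => Iff.rfl⟩⟩

instance Def2.eq : Def2 E A (@Eq α) := ⟨⟨.eq (.var 0) (.var 1), fun _ => Iff.rfl⟩⟩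

theorem Def1.cls : Def1 E A (· ∈ A) := ⟨⟨.cls (.var 0), fun _ => Iff.rfl⟩⟩

theorem DfnT.of_iff {f : (ℕ → α) → α} {P : (ℕ → α) → α → Prop}
    (hP : Dfn E A fun t => P (fun n => t (n + 1)) (t 0)) (h : ∀ t y, y = f t ↔ P t y) :
    DfnT E A f :=
  ⟨hP.of_iff fun _ => h _ _⟩

instance DefF1.app {F : α → α} {f : (ℕ → α) → α} [hF : DefF1 E A F] [hf : DfnT E A f] :
    DfnT E A fun t => F (f t) := by
  have : Def2 E A fun y x => y = F x := ⟨hF.out.out⟩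
  have := hf.rename (· + 1)
  exact ⟨Def2.app (R := fun y x => y = F x) (f := fun t => t 0)⟩

instance DefF2.app {F : α → α → α} {f g : (ℕ → α) → α} [hF : DefF2 E A F] [hf : DfnT E A f]
    [hg : DfnT E A g] : DfnT E A fun t => F (f t) (g t) := by
  have : Def3 E A fun z x y => z = F x y := ⟨hF.out.out⟩
  have := hf.rename (· + 1)
  have := hg.rename (· + 1)
  exact ⟨Def3.app (R := fun z x y => z = F x y) (f := fun t => t 0)⟩

end Closure

end

section

variable {α : Type*}

/-- Renaming of all set variables of a formula, bound ones included. -/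
def Fml.rename (f : ℕ → ℕ) : Fml → Fml
  | .memSS i j => .memSS (f i) (f j)
  | .memSC i j => .memSC (f i) j
  | .eqS i j => .eqS (f i) (f j)
  | .fal => .fal
  | .imp φ ψ => .imp (φ.rename f) (ψ.rename f)
  | .allS i φ => .allS (f i) (φ.rename f)
  | .allC i φ => .allC i (φ.rename f)

theorem Fml.IsPure.rename {f : ℕ → ℕ} : ∀ {φ : Fml}, φ.IsPure → (φ.rename f).IsPure
  | .memSS _ _, _ => trivial
  | .eqS _ _, _ => trivial
  | .fal, _ => trivial
  | .imp _ _, h => ⟨h.1.rename, h.2.rename⟩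
  | .allS _ φ, h => IsPure.rename (φ := φ) h

theorem Fml.IsPure.isElementary : ∀ {φ : Fml}, φ.IsPure → φ.IsElementary
  | .memSS _ _, _ => trivial
  | .eqS _ _, _ => trivial
  | .fal, _ => trivial
  | .imp _ _, h => ⟨h.1.isElementary, h.2.isElementary⟩
  | .allS _ φ, h => isElementary (φ := φ) h

theorem sat_rename (D : Set α) (E : α → α → Prop) (𝒳 : Set (Set α)) {f : ℕ → ℕ}
    (hf : Function.Injective f) (φ : Fml) : ∀ (s : ℕ → α) (c : ℕ → Set α),
      Sat D E 𝒳 (φ.rename f) s c ↔ Sat D E 𝒳 φ (s ∘ f) c := by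
  induction φ with
  | memSS i j => intros; rfl
  | memSC i j => intros; rfl
  | eqS i j => intros; rfl
  | fal => intros; rfl
  | imp φ ψ ih₁ ih₂ => intro s c; simp only [Fml.rename, Sat, ih₁, ih₂]
  | allS i φ ih =>
    intro s c
    simp only [Fml.rename, Sat, ih, Function.update_comp_eq_of_injective s hf]
  | allC i φ ih => intro s c; simp only [Fml.rename, Sat, ih]

theorem sat_pure_congr (D : Set α) (E : α → α → Prop) (𝒳 𝒴 : Set (Set α)) (φ : Fml) :
    φ.IsPure → ∀ (s : ℕ → α) (c d : ℕ → Set α), Sat D E 𝒳 φ s c ↔ Sat D E 𝒴 φ s d := by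
  induction φ with
  | memSS i j => intros; rfl
  | memSC i j => intro h; exact h.elim
  | eqS i j => intros; rfl
  | fal => intros; rfl
  | imp φ ψ ih₁ ih₂ => intro h s c d; simp only [Sat, ih₁ h.1 s c d, ih₂ h.2 s c d]
  | allS i φ ih => intro h s c d; simp only [Sat, ih h _ c d]
  | allC i φ ih => intro h; exact h.elim

/-- The stream with the values of `t` at even and those of `p` at odd places. -/
def merge (t p : ℕ → α) (n : ℕ) : α := if n % 2 = 0 then t (n / 2) else p (n / 2)

theorem merge_even (t p : ℕ → α) (n : ℕ) : merge t p (2 * n) = t n := by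
  simp [merge]

theorem merge_odd (t p : ℕ → α) (n : ℕ) : merge t p (2 * n + 1) = p n := by
  have h₁ : (2 * n + 1) % 2 ≠ 0 := by omega
  have h₂ : (2 * n + 1) / 2 = n := by omega
  rw [merge, if_neg h₁, h₂]

theorem merge_comp {t p t' p' : ℕ → α} {f : ℕ → ℕ} (h₀ : ∀ n, merge t p (f (2 * n)) = t' n)
    (h₁ : ∀ n, merge t p (f (2 * n + 1)) = p' n) : merge t p ∘ f = merge t' p' := by
  funext n
  obtain ⟨k, rfl | rfl⟩ := Nat.even_or_odd' n
  · rw [Function.comp, h₀, merge_even]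
  · rw [Function.comp, h₁, merge_odd]

/-- A predicate of streams defined by a pure formula with parameters at odd places. -/
def PureDfn (E : α → α → Prop) (P : (ℕ → α) → Prop) : Prop :=
  ∃ ψ : Fml, ψ.IsPure ∧ ∃ p : ℕ → α, ∀ t,
    P t ↔ Sat Set.univ E ∅ ψ (merge t p) fun _ => (∅ : Set α)

theorem DTm.exists_merge [Nonempty α] (a : DTm α) (i : ℕ) :
    ∃ (k : ℕ) (c : α), ∀ t p : ℕ → α, p i = c → merge t p k = a.eval t := by
  cases a with
  | var n => exact ⟨2 * n, Classical.arbitrary α, fun t p _ => merge_even t p n⟩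
  | cst c => exact ⟨2 * i + 1, c, fun t p h => (merge_odd t p i).trans h⟩

theorem DTm.exists_merge₂ [Nonempty α] (a b : DTm α) :
    ∃ (k l : ℕ) (p : ℕ → α), ∀ t, merge t p k = a.eval t ∧ merge t p l = b.eval t := by
  obtain ⟨k, c, hk⟩ := a.exists_merge 0
  obtain ⟨l, d, hl⟩ := b.exists_merge 1
  exact ⟨k, l, fun n => if n = 0 then c else d, fun t => ⟨hk _ _ rfl, hl _ _ rfl⟩⟩

theorem DFm.pureDfn [Nonempty α] (E : α → α → Prop) (φ : DFm α) :
    PureDfn E fun t => φ.eval E ∅ t := by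
  induction φ with
  | mem a b =>
    obtain ⟨k, l, p, h⟩ := a.exists_merge₂ b
    exact ⟨.memSS k l, trivial, p, fun t => by simp only [DFm.eval, Sat, h]⟩
  | cls a => exact ⟨.fal, trivial, fun _ => Classical.arbitrary α, fun t => Iff.rfl⟩
  | eq a b =>
    obtain ⟨k, l, p, h⟩ := a.exists_merge₂ b
    exact ⟨.eqS k l, trivial, p, fun t => by simp only [DFm.eval, Sat, h]⟩
  | fal => exact ⟨.fal, trivial, fun _ => Classical.arbitrary α, fun t => Iff.rfl⟩
  | imp φ ψ ih₁ ih₂ =>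
    obtain ⟨φ', hφ', p, hp⟩ := ih₁
    obtain ⟨ψ', hψ', q, hq⟩ := ih₂
    beta_reduce at hp hq
    let f (i n : ℕ) : ℕ := if n % 2 = 0 then n else 2 * n + 1 + 2 * i - 2
    have hf (i : ℕ) (hi : i < 2) : Function.Injective (f i) := by
      intro m n h
      simp only [f] at h
      split_ifs at h <;> omega
    have he (i n : ℕ) : f i (2 * n) = 2 * n := by simp [f]
    have ho (i n : ℕ) : f i (2 * n + 1) = 2 * (2 * n + i) + 1 := by simp only [f]; split_ifs <;> omega
    refine ⟨.imp (φ'.rename (f 0)) (ψ'.rename (f 1)), ⟨hφ'.rename, hψ'.rename⟩, merge p q,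
      fun t => ?_⟩
    simp only [DFm.eval, Sat, sat_rename _ _ _ (hf 0 (by omega)),
      sat_rename _ _ _ (hf 1 (by omega))]
    rw [merge_comp (t' := t) (p' := p), merge_comp (t' := t) (p' := q), hp, hq]
    · intro n; rw [he, merge_even]
    · intro n; rw [ho, merge_odd, merge_odd]
    · intro n; rw [he, merge_even]
    · intro n; rw [ho, merge_odd, Nat.add_zero, merge_even]
  | all φ ih =>
    obtain ⟨φ', hφ', p, hp⟩ := ih
    beta_reduce at hp
    let f (n : ℕ) : ℕ := if n = 0 then 1 else if n % 2 = 0 then n - 2 else n + 2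
    have hf : Function.Injective f := by
      intro m n h
      simp only [f] at h
      split_ifs at h <;> omega
    refine ⟨.allS 1 (φ'.rename f), hφ'.rename, scons (p 0) p, fun t => ?_⟩
    simp only [DFm.eval, Sat, sat_rename _ _ _ hf, Set.mem_univ, true_implies]
    refine forall_congr' fun x => ?_
    rw [hp]
    congr! 1
    funext n
    obtain ⟨k, rfl | rfl⟩ := Nat.even_or_odd' n
    · cases k with
      | zero => rfl
      | succ k =>
        have : f (2 * (k + 1)) = 2 * k := by
          simp only [f]; rw [if_neg (by omega), if_pos (by omega)]; omega
        rw [Function.comp, this, Function.update_of_ne (by omega), merge_even, merge_even]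
        rfl
    · have : f (2 * k + 1) = 2 * (k + 1) + 1 := by
        simp only [f]; rw [if_neg (by omega), if_neg (by omega)]; omega
      rw [Function.comp, this, Function.update_of_ne (by omega), merge_odd, merge_odd]
      rfl

theorem Dfn.pureDfn [Nonempty α] {E : α → α → Prop} {P : (ℕ → α) → Prop} (h : Dfn E ∅ P) :
    PureDfn E P := by
  obtain ⟨φ, hφ⟩ := h.out
  obtain ⟨ψ, hψ, p, hp⟩ := φ.pureDfn E
  exact ⟨ψ, hψ, p, fun t => (hφ t).trans (hp t)⟩

theorem dfn_update {E : α → α → Prop} {A : Set α} {P : (ℕ → α) → Prop} (h : Dfn E A P)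
    (i : ℕ) : Dfn E A fun t => P (Function.update (fun n => t (n + 1)) i (t 0)) :=
  (h.rename fun n => if n = i then 0 else n + 1).of_iff fun t => by
    congr! 1
    funext n
    by_cases hn : n = i <;> simp [hn]

/-- Elementary formulas with definable class parameters define definable predicates. -/
theorem dfn_sat (E : α → α → Prop) (A : Set α) (𝒳 : Set (Set α)) (c : ℕ → Set α)
    (hc : ∀ n, Def1 E A (· ∈ c n)) (φ : Fml) :
    φ.IsElementary → Dfn E A fun t => Sat Set.univ E 𝒳 φ t c := by
  induction φ with
  | memSS i j => intro _; exact Def2.app (R := E) (f := fun t => t i)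
  | memSC i j => intro _; have := hc j; exact Def1.app (P := (· ∈ c j)) (f := fun t => t i)
  | eqS i j => intro _; exact Def2.app (R := Eq) (f := fun t => t i)
  | fal => intro _; exact Dfn.const False
  | imp φ ψ ih₁ ih₂ => intro h; have := ih₁ h.1; have := ih₂ h.2; exact Dfn.imp
  | allS i φ ih =>
    intro h
    have := dfn_update (ih h) i
    exact (Dfn.all (P := fun t x => Sat Set.univ E 𝒳 φ (Function.update t i x) c)).of_iff
      fun t => by simp only [Sat, Set.mem_univ, true_implies]
  | allC i φ ih => intro h; exact h.elim

theorem def1_sat (E : α → α → Prop) (A : Set α) (𝒳 : Set (Set α)) (c : ℕ → Set α)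
    (hc : ∀ n, Def1 E A (· ∈ c n)) {φ : Fml} (hφ : φ.IsElementary) (s : ℕ → α) :
    Def1 E A fun x => Sat Set.univ E 𝒳 φ (Function.update s 0 x) c :=
  ⟨((dfn_sat E A 𝒳 c hc φ hφ).subst fun n => if n = 0 then .var 0 else .cst (s n)).of_iff
    fun t => by
      congr! 1
      funext n
      by_cases hn : n = 0 <;> simp [hn, DTm.eval]⟩

/-- The classes definable over `(α, E, A)` with set parameters. -/
def defClasses (E : α → α → Prop) (A : Set α) : Set (Set α) := {X | Def1 E A (· ∈ X)}

theorem PureDfn.exists_update [Nonempty α] {E : α → α → Prop} {P : (ℕ → α) → Prop}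
    (h : PureDfn E P) (d : α) : ∃ ψ : Fml, ψ.IsPure ∧ ∃ s : ℕ → α, ∀ x y,
      P (scons x (scons y fun _ => d)) ↔ Sat Set.univ E ∅ ψ
        (Function.update (Function.update s 0 x) 1 y) fun _ => (∅ : Set α) := by
  obtain ⟨ψ, hψ, p, hp⟩ := h
  refine ⟨ψ.rename (Equiv.swap 1 2), hψ.rename,
    merge (fun _ => d) p ∘ Equiv.swap 1 2, fun x y => ?_⟩
  rw [hp, sat_rename _ _ _ (Equiv.injective _)]
  congr! 1
  funext n
  have h2 : merge (scons x (scons y fun _ => d)) p 2 = y := merge_even _ _ 1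
  have h1 (t : ℕ → α) : merge t p 1 = p 0 := merge_odd _ _ 0
  by_cases hn0 : n = 0
  · subst hn0; rfl
  by_cases hn1 : n = 1
  · subst hn1; simp [h1]
  by_cases hn2 : n = 2
  · subst hn2; simp [h2]
  have e : Equiv.swap 1 2 n = n := Equiv.swap_apply_of_ne_of_ne hn1 hn2
  simp only [Function.comp, e, Function.update_apply, hn0, hn1, if_false]
  obtain ⟨k, rfl | rfl⟩ := Nat.even_or_odd' n
  · obtain ⟨k, rfl⟩ : ∃ m, k = m + 2 := ⟨k - 2, by omega⟩
    rw [merge_even, merge_even]; rfl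
  · rw [merge_odd, merge_odd]

theorem def0_eq_defClasses [Nonempty α] (E : α → α → Prop) :
    Def0 Set.univ E = defClasses E ∅ := by
  ext X
  constructor
  · rintro ⟨φ, hφ, s, -, rfl⟩
    have hc (n : ℕ) : Def1 E ∅ (· ∈ ((fun _ => ∅) : ℕ → Set α) n) := Def1.cls
    have := def1_sat E ∅ ∅ _ hc hφ.isElementary s
    simpa [defClasses] using this
  · intro h
    obtain ⟨ψ, hψ, p, hp⟩ := Dfn.pureDfn (Def1.out (self := h))
    refine ⟨ψ, hψ, merge (fun _ => Classical.arbitrary α) p, fun _ => trivial, ?_⟩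
    ext x
    simp only [Set.mem_ofPred_eq, Set.mem_univ, true_and]
    refine (hp (scons x fun _ => Classical.arbitrary α)).trans ?_
    congr! 1
    funext n
    obtain ⟨k, rfl | rfl⟩ := Nat.even_or_odd' n
    · cases k with
      | zero => rfl
      | succ k => rw [Function.update_of_ne (by omega), merge_even, merge_even]; rfl
    · rw [Function.update_of_ne (by omega), merge_odd, merge_odd]

/-- `(α, E)` satisfies the single axioms of `ZF`. -/
class SetAxioms (E : α → α → Prop) : Prop where
  exten : ∀ x y, (∀ z, E z x ↔ E z y) → x = y
  pairing : ∀ x y, ∃ p, ∀ z, E z p ↔ (z = x ∨ z = y)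
  union : ∀ x, ∃ u, ∀ z, E z u ↔ ∃ w, E w x ∧ E z w
  power : ∀ x, ∃ p, ∀ z, E z p ↔ ∀ w, E w z → E w x
  infinity : ∃ I, (∃ e, E e I ∧ ∀ z, ¬ E z e) ∧
    ∀ x, E x I → ∃ s, E s I ∧ ∀ z, (E z s ↔ (E z x ∨ z = x))
  foundation : ∀ x, (∃ z, E z x) → ∃ m, E m x ∧ ∀ z, E z m → ¬ E z x

/-- `(α, E, A)` satisfies Replacement for formulas mentioning `A`. -/
class Replacement (E : α → α → Prop) (A : Set α) : Prop where
  replacement : ∀ R : α → α → Prop, Def2 E A R → (∀ x y y', R x y → R x y' → y = y') →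
    ∀ a, ∃ b, ∀ y, E y b ↔ ∃ x, E x a ∧ R x y

theorem ZFModel.setAxioms {E : α → α → Prop} (h : ZFModel Set.univ E) : SetAxioms E :=
  ⟨by simpa using h.exten, by simpa using h.pairing, by simpa using h.union,
    by simpa using h.power, by simpa using h.infinity, by simpa using h.foundation⟩

theorem ZFModel.replacement_empty {E : α → α → Prop} (h : ZFModel Set.univ E) :
    Replacement E ∅ := by
  have : Nonempty α := ⟨h.nonempty.choose⟩
  refine ⟨?_⟩
  intro R hR hfun a
  obtain ⟨ψ, hψ, s, hs⟩ := hR.out.pureDfn.exists_update (Classical.arbitrary α)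
  simp only [scons] at hs
  have := h.replacement ψ hψ s (fun _ => trivial)
  simp only [← hs, Set.mem_univ, true_implies, true_and] at this
  exact this (fun x y y' => hfun x y y') a

theorem isKPair_iff {E : α → α → Prop} {p a b : α} : IsKPair Set.univ E p a b ↔
    ∀ z, E z p ↔ ((∀ w, E w z ↔ w = a) ∨ (∀ w, E w z ↔ (w = a ∨ w = b))) := by
  simp [IsKPair]

instance {E : α → α → Prop} {A : Set α} : Def3 E A (IsKPair Set.univ E) := by
  refine ⟨?_⟩
  simp only [isKPair_iff]
  infer_instance

theorem def2_pairIn {E : α → α → Prop} {A F : Set α} [Def1 E A (· ∈ F)] :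
    Def2 E A (PairIn Set.univ E F) := by
  refine ⟨?_⟩
  unfold PairIn
  exact (inferInstance : Dfn E A fun t => ∃ p, (· ∈ F) p ∧ IsKPair Set.univ E p (t 0) (t 1))

/-- The definable classes of a model of `ZF(A)` form a model of `GB`. -/
theorem gbModel_defClasses {E : α → α → Prop} {A : Set α} [h : Replacement E A]
    (hzf : ZFModel Set.univ E) : GBModel Set.univ E (defClasses E A) where
  classes_sub _ _ := Set.subset_univ _
  zf := hzf
  classRepl F hF hfun a _ := by
    have : Def1 E A (· ∈ F) := hF
    simpa using h.replacement _ def2_pairIn hfun a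
  elemComp φ hφ s _ c hc :=
    ⟨{x | Sat Set.univ E (defClasses E A) φ (Function.update s 0 x) c},
      def1_sat E A _ c hc hφ s, fun _ _ => Iff.rfl⟩

/-- Every `GB`-realization contains all definable classes. -/
theorem def0_subset_of_gbModel {E : α → α → Prop} {𝒳 : Set (Set α)} (h : GBModel Set.univ E 𝒳)
    (hne : 𝒳.Nonempty) : Def0 Set.univ E ⊆ 𝒳 := by
  rintro _ ⟨φ, hφ, s, hs, rfl⟩
  obtain ⟨C, hC⟩ := hne
  obtain ⟨X, hX, hXφ⟩ := h.elemComp φ hφ.isElementary s hs (fun _ => C) fun _ => hC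
  convert hX
  ext x
  simp only [Set.mem_ofPred_eq, Set.mem_univ, true_and, hXφ x trivial]
  exact sat_pure_congr _ _ _ _ φ hφ _ _ _

end

section

variable {α : Type*} [Nonempty α]

/-- The unique element satisfying `P`, with a fixed default. -/
noncomputable def iota (P : α → Prop) : α :=
  Classical.epsilon fun y => P y ∧ ∀ y', P y' → y' = y

theorem iota_eq {P : α → Prop} {y : α} (h : P y) (hu : ∀ y', P y' → y' = y) : iota P = y :=
  hu _ (Classical.epsilon_spec (p := fun y => P y ∧ ∀ y', P y' → y' = y) ⟨y, h, hu⟩).1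

theorem iota_spec {P : α → Prop} (h : ∃! y, P y) : P (iota P) := by
  obtain ⟨y, h, hu⟩ := h
  rwa [iota_eq h hu]

/-- The set with extension `P`, with a fixed default. -/
noncomputable def collect (E : α → α → Prop) (P : α → Prop) : α :=
  iota fun b => ∀ z, E z b ↔ P z

/-- `P` is the extension of a set. -/
def IsSet (E : α → α → Prop) (P : α → Prop) : Prop := ∃ b, ∀ z, E z b ↔ P z

section Collect

variable {E : α → α → Prop} {A : Set α}

instance DfnT.iota {P : (ℕ → α) → α → Prop} [h : Dfn E A fun t => P (fun n => t (n + 1)) (t 0)] :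
    DfnT E A fun t => iota (P t) := by
  have h₂ : Dfn E A fun t => P (fun n => t (n + 2)) (t 0) :=
    h.rename fun n => if n = 0 then 0 else n + 1
  have h₃ : Dfn E A fun t => P (fun n => t (n + 3)) (t 0) :=
    h.rename fun n => if n = 0 then 0 else n + 2
  have h₃' : Dfn E A fun t => P (fun n => t (n + 3)) (t 1) :=
    h.rename fun n => if n = 0 then 1 else n + 2
  have h₂' : Dfn E A fun t => P (fun n => t (n + 2)) (t 1) :=
    h.rename fun n => if n = 0 then 1 else n + 1
  let c : α := SOST.iota fun _ : α => False
  refine DfnT.of_iff (P := fun t y => (P t y ∧ ∀ y', P t y' → y' = y) ∨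
    ((¬ ∃ z, P t z ∧ ∀ y', P t y' → y' = z) ∧ y = c)) inferInstance fun t y => ?_
  by_cases hu : ∃ z, P t z ∧ ∀ y', P t y' → y' = z
  · obtain ⟨z, hz, hz'⟩ := hu
    rw [iota_eq hz hz']
    constructor
    · rintro rfl; exact .inl ⟨hz, hz'⟩
    · rintro (h | h)
      · exact hz' _ h.1
      · exact (h.1 ⟨z, hz, hz'⟩).elim
  · have : SOST.iota (P t) = c := by
      unfold c SOST.iota
      congr 1
      funext y
      have : ¬ (P t y ∧ ∀ y', P t y' → y' = y) := fun h => hu ⟨y, h⟩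
      simp [this]
    rw [this]
    constructor
    · exact fun h => .inr ⟨hu, h⟩
    · rintro (h | h)
      · exact (hu ⟨y, h⟩).elim
      · exact h.2

instance DfnT.collect {P : (ℕ → α) → α → Prop}
    [h : Dfn E A fun t => P (fun n => t (n + 1)) (t 0)] :
    DfnT E A fun t => collect E (P t) := by
  have h₂ : Dfn E A fun t => P (fun n => t (n + 2)) (t 0) :=
    h.rename fun n => if n = 0 then 0 else n + 1
  exact (inferInstance : DfnT E A fun t => SOST.iota fun b => ∀ z, E z b ↔ P t z)

variable [SetAxioms E]

theorem mem_ext {x y : α} (h : ∀ z, E z x ↔ E z y) : x = y := SetAxioms.exten x y h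

theorem IsSet.mem_collect {P : α → Prop} (h : IsSet E P) {z : α} : E z (collect E P) ↔ P z := by
  obtain ⟨b, hb⟩ := h
  rw [SOST.collect, iota_eq hb fun y hy => mem_ext fun z => (hy z).trans (hb z).symm]
  exact hb z

theorem IsSet.collect_eq {P : α → Prop} {b : α} (h : ∀ z, E z b ↔ P z) : collect E P = b :=
  mem_ext (E := E) fun z => (IsSet.mem_collect ⟨b, h⟩).trans (h z).symm

theorem isSet_mem (x : α) : IsSet E (E · x) := ⟨x, fun _ => Iff.rfl⟩

theorem IsSet.of_iff {P Q : α → Prop} (h : IsSet E P) (hPQ : ∀ x, Q x ↔ P x) : IsSet E Q :=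
  h.imp fun _ hb z => (hb z).trans (hPQ z).symm

variable (A) in
theorem IsSet.image [Replacement E A] {P : α → Prop} (h : IsSet E P) (R : α → α → Prop)
    [hR : Dfn E A fun t => R (t 0) (t 1)] (hfun : ∀ x y y', P x → R x y → R x y' → y = y') :
    IsSet E fun y => ∃ x, P x ∧ R x y := by
  obtain ⟨a, ha⟩ := h
  have : Def2 E A R := ⟨hR⟩
  obtain ⟨b, hb⟩ := Replacement.replacement (E := E) (A := A) (fun x y => E x a ∧ R x y)
    ⟨inferInstance⟩ (fun x y y' h h' => hfun x y y' ((ha x).1 h.1) h.2 h'.2) a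
  refine ⟨b, fun y => (hb y).trans (exists_congr fun x => ?_)⟩
  rw [ha]; tauto

variable (A) in
theorem IsSet.sep [Replacement E A] {P Q : α → Prop} (h : IsSet E P)
    [hQ : Dfn E A fun t => Q (t 0)] (hQP : ∀ x, Q x → P x) : IsSet E Q := by
  have : Def1 E A Q := ⟨hQ⟩
  refine (h.image A (fun x y => x = y ∧ Q x) ?_).of_iff fun x => ?_
  · rintro x y y' - ⟨rfl, -⟩ ⟨rfl, -⟩; rfl
  · exact ⟨fun hx => ⟨x, hQP x hx, rfl, hx⟩, fun ⟨y, _, e, hy⟩ => e ▸ hy⟩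

variable (A) in
theorem IsSet.imageF [Replacement E A] {P : α → Prop} (h : IsSet E P) (F : α → α)
    [hF : DfnT E A fun t => F (t 0)] : IsSet E fun y => ∃ x, P x ∧ y = F x := by
  have : DefF1 E A F := ⟨hF⟩
  exact h.image A (fun x y => y = F x) fun x y y' _ h h' => h.trans h'.symm

variable (A) in
theorem IsSet.biUnion [Replacement E A] {P : α → Prop} (h : IsSet E P) (Q : α → α → Prop)
    [hQ : Dfn E A fun t => Q (t 0) (t 1)] (hs : ∀ x, P x → IsSet E (Q x)) :
    IsSet E fun z => ∃ x, P x ∧ Q x z := by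
  have : Def2 E A Q := ⟨hQ⟩
  obtain ⟨b, hb⟩ := h.imageF A fun x => collect E (Q x)
  obtain ⟨u, hu⟩ := SetAxioms.union (E := E) b
  refine ⟨u, fun z => (hu z).trans ?_⟩
  constructor
  · rintro ⟨w, hw, hz⟩
    obtain ⟨x, hx, rfl⟩ := (hb w).1 hw
    exact ⟨x, hx, (hs x hx).mem_collect.1 hz⟩
  · rintro ⟨x, hx, hz⟩
    exact ⟨_, (hb _).2 ⟨x, hx, rfl⟩, (hs x hx).mem_collect.2 hz⟩

theorem isSet_pair (x y : α) : IsSet E fun z => z = x ∨ z = y := SetAxioms.pairing x y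

theorem isSet_singleton (x : α) : IsSet E fun z => z = x := (isSet_pair x x).of_iff (by simp)

theorem isSet_power (x : α) : IsSet E fun z => ∀ w, E w z → E w x := SetAxioms.power x

theorem IsSet.or {P Q : α → Prop} (hP : IsSet E P) (hQ : IsSet E Q) :
    IsSet E fun z => P z ∨ Q z := by
  obtain ⟨a, ha⟩ := hP
  obtain ⟨b, hb⟩ := hQ
  obtain ⟨p, hp⟩ := SetAxioms.pairing (E := E) a b
  obtain ⟨u, hu⟩ := SetAxioms.union (E := E) p
  refine ⟨u, fun z => (hu z).trans ?_⟩
  simp [hp, ha, hb, or_and_right, exists_or]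

theorem isSet_union (x : α) : IsSet E fun z => ∃ w, E w x ∧ E z w := SetAxioms.union x

end Collect

section Pairs

variable (E : α → α → Prop) {A : Set α}

/-- The Kuratowski pair. -/
noncomputable def kp (x y : α) : α :=
  collect E fun z => z = collect E (fun w => w = x) ∨ z = collect E fun w => w = x ∨ w = y

/-- The power set. -/
noncomputable def pow (x : α) : α := collect E fun z => ∀ w, E w z → E w x

instance : DefF2 E A (kp E) := ⟨by unfold kp; infer_instance⟩

instance : DefF1 E A (pow E) := ⟨by unfold pow; infer_instance⟩

variable {E} [SetAxioms E]

theorem mem_pow {x z : α} : E z (pow E x) ↔ ∀ w, E w z → E w x := (isSet_power x).mem_collect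

theorem collect_singleton_inj {x y : α} :
    collect E (fun w => w = x) = collect E (fun w => w = y) ↔ x = y := by
  refine ⟨fun h => ?_, fun h => by rw [h]⟩
  have : E x (collect E fun w => w = y) := h ▸ (isSet_singleton x).mem_collect.2 rfl
  exact (isSet_singleton y).mem_collect.1 this

theorem isKPair_iff_eq {p a b : α} : IsKPair Set.univ E p a b ↔ p = kp E a b := by
  have h₁ (z : α) : (∀ w, E w z ↔ w = a) ↔ z = collect E fun w => w = a :=
    ⟨fun h => (IsSet.collect_eq h).symm, fun h w => h ▸ (isSet_singleton a).mem_collect⟩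
  have h₂ (z : α) : (∀ w, E w z ↔ (w = a ∨ w = b)) ↔ z = collect E fun w => w = a ∨ w = b :=
    ⟨fun h => (IsSet.collect_eq h).symm, fun h w => h ▸ (isSet_pair a b).mem_collect⟩
  simp only [isKPair_iff, h₁, h₂]
  exact ⟨fun h => (IsSet.collect_eq h).symm, fun h z => h ▸ (isSet_pair _ _).mem_collect⟩

theorem kp_inj {a b c d : α} : kp E a b = kp E c d ↔ a = c ∧ b = d := by
  refine ⟨fun h => ?_, fun h => by rw [h.1, h.2]⟩
  have key (x y z : α) : collect E (fun w => w = x) = collect E (fun w => w = y ∨ w = z) →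
      x = y ∧ x = z := fun e => by
    have h₁ : ∀ w, w = x ↔ (w = y ∨ w = z) := fun w => by
      rw [← (isSet_singleton (E := E) x).mem_collect, e, (isSet_pair (E := E) y z).mem_collect]
    exact ⟨((h₁ y).2 (.inl rfl)).symm, ((h₁ z).2 (.inr rfl)).symm⟩
  have h₁ : ∀ z, (z = collect E (fun w => w = a) ∨ z = collect E fun w => w = a ∨ w = b) ↔
      (z = collect E (fun w => w = c) ∨ z = collect E fun w => w = c ∨ w = d) := fun z => by
    rw [← (isSet_pair (E := E) _ _).mem_collect, ← (isSet_pair (E := E) _ _).mem_collect]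
    exact iff_of_eq (congrArg (E z) h)
  have hac : a = c := by
    rcases (h₁ _).1 (.inl rfl) with e | e
    · exact collect_singleton_inj.1 e
    · exact (key _ _ _ e).1
  subst hac
  refine ⟨rfl, ?_⟩
  have h₂ (b d : α) (h : collect E (fun w => w = a ∨ w = b) = collect E (fun w => w = a) ∨
      collect E (fun w => w = a ∨ w = b) = collect E (fun w => w = a ∨ w = d)) :
      b = a ∨ b = d := by
    rcases h with e | e
    · exact .inl (key _ _ _ e.symm).2.symm
    · rw [← (isSet_pair (E := E) a d).mem_collect, ← e]
      exact (isSet_pair _ _).mem_collect.2 (.inr rfl)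
  have hb := h₂ b d ((h₁ _).1 (.inr rfl))
  have hd := h₂ d b ((h₁ _).2 (.inr rfl))
  rcases hb with rfl | rfl
  · rcases hd with h | h <;> exact h.symm
  · rfl

end Pairs

end

section

variable {α : Type*} [Nonempty α]

section Recursion

variable {E : α → α → Prop} {A : Set α}

theorem collect_congr {P Q : α → Prop} (h : ∀ x, P x ↔ Q x) : collect E P = collect E Q :=
  congrArg _ (funext fun x => propext (h x))

/-- A definable transitive set-like relation with induction for definable classes. -/
structure Recursive (E : α → α → Prop) (A : Set α) (R : α → α → Prop) : Prop where
  def2 : Def2 E A R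
  trans : ∀ {a b c}, R a b → R b c → R a c
  isSet : ∀ b, IsSet E (R · b)
  induction : ∀ P : α → Prop, Def1 E A P → (∀ b, (∀ c, R c b → P c) → P b) → ∀ b, P b

/-- `f` is an attempt at the recursion along `R` with step `H` below `b`. -/
def Attempt (E : α → α → Prop) (R : α → α → Prop) (H : α → α → α) (f b : α) : Prop :=
  ∀ c u, R c b → (E (kp E c u) f ↔ u = H c (collect E fun v => ∃ d, R d c ∧ E (kp E d v) f))

/-- `z` is the value at `b` obtained from some attempt. -/
def RecVal (E : α → α → Prop) (R : α → α → Prop) (H : α → α → α) (b z : α) : Prop :=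
  ∃ f, Attempt E R H f b ∧ z = H b (collect E fun u => ∃ c, R c b ∧ E (kp E c u) f)

instance {R : α → α → Prop} {H : α → α → α} [Def2 E A R] [DefF2 E A H] :
    Def2 E A (Attempt E R H) := ⟨by unfold Attempt; infer_instance⟩

instance {R : α → α → Prop} {H : α → α → α} [Def2 E A R] [DefF2 E A H] :
    Def2 E A (RecVal E R H) := ⟨by unfold RecVal; infer_instance⟩

theorem Recursive.exists_rec [SetAxioms E] [Replacement E A] {R : α → α → Prop}
    (hR : Recursive E A R) (H : α → α → α) [hH : DefF2 E A H] :
    ∃ F : α → α, DefF1 E A F ∧ ∀ b, F b = H b (collect E fun u => ∃ c, R c b ∧ u = F c) := by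
  have := hR.def2
  have key {b f : α} (ih : ∀ c, R c b → ∃! z, RecVal E R H c z) (hf : Attempt E R H f b)
      {c u : α} (hc : R c b) : E (kp E c u) f ↔ RecVal E R H c u := by
    have h₁ : RecVal E R H c (H c (collect E fun v => ∃ d, R d c ∧ E (kp E d v) f)) :=
      ⟨f, fun d u hd => hf d u (hR.trans hd hc), rfl⟩
    rw [hf c u hc]
    exact ⟨fun h => h ▸ h₁, fun h => (ih c hc).unique h h₁⟩
  have val {b : α} (ih : ∀ c, R c b → ∃! z, RecVal E R H c z) {z : α} (hz : RecVal E R H b z) :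
      z = H b (collect E fun u => ∃ c, R c b ∧ RecVal E R H c u) := by
    obtain ⟨f, hf, rfl⟩ := hz
    refine congrArg _ (collect_congr fun u => exists_congr fun c => and_congr_right fun hc => ?_)
    exact key ih hf hc
  have main : ∀ b, ∃! z, RecVal E R H b z := by
    refine hR.induction _ ⟨?_⟩ fun b ih => ?_
    · unfold ExistsUnique; infer_instance
    · have hs := (hR.isSet b).imageF A fun c => kp E c (iota (RecVal E R H c))
      set f := collect E fun p => ∃ c, R c b ∧ p = kp E c (iota (RecVal E R H c)) with hf
      have hmem {c u : α} (hc : R c b) : E (kp E c u) f ↔ RecVal E R H c u := by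
        rw [hf, hs.mem_collect]
        constructor
        · rintro ⟨d, hd, e⟩
          obtain ⟨rfl, rfl⟩ := kp_inj.1 e
          exact iota_spec (ih c hd)
        · exact fun h => ⟨c, hc, by rw [(ih c hc).unique h (iota_spec (ih c hc))]⟩
      have hatt : Attempt E R H f b := by
        intro c u hc
        have ih' : ∀ d, R d c → ∃! z, RecVal E R H d z := fun d hd => ih d (hR.trans hd hc)
        have e : (collect E fun v => ∃ d, R d c ∧ E (kp E d v) f) =
            collect E fun v => ∃ d, R d c ∧ RecVal E R H d v :=
          collect_congr fun v => exists_congr fun d => and_congr_right fun hd =>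
            hmem (hR.trans hd hc)
        rw [hmem hc, e]
        refine ⟨val ih', fun h => ?_⟩
        obtain ⟨z, hz, -⟩ := ih c hc
        rw [h, ← val ih' hz]
        exact hz
      exact ⟨_, ⟨f, hatt, rfl⟩, fun z hz => (val ih hz).trans (val ih ⟨f, hatt, rfl⟩).symm⟩
  refine ⟨fun b => iota (RecVal E R H b), ⟨inferInstance⟩, fun b => ?_⟩
  refine (val (fun c _ => main c) (iota_spec (main b))).trans ?_
  refine congrArg _ (collect_congr fun u => exists_congr fun c => and_congr_right fun _ => ?_)
  exact ⟨fun h => (main c).unique h (iota_spec (main c)), fun h => h ▸ iota_spec (main c)⟩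

theorem induction_of_sub [SetAxioms E] [Replacement E A] {R : α → α → Prop} [Def2 E A R]
    (htrans : ∀ {a b c}, R a b → R b c → R a c) (hsub : ∀ {a b}, R a b → E a b)
    (P : α → Prop) [Def1 E A P] (h : ∀ b, (∀ c, R c b → P c) → P b) (b : α) : P b := by
  refine h b ?_
  by_contra! hc
  obtain ⟨c, hc, hPc⟩ := hc
  obtain ⟨s, hs⟩ := (isSet_mem b).sep A (Q := fun c => R c b ∧ ¬ P c) fun x hx => hsub hx.1
  obtain ⟨m, hm, hmin⟩ := SetAxioms.foundation s ⟨c, (hs c).2 ⟨hc, hPc⟩⟩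
  have hm' := (hs m).1 hm
  refine hm'.2 (h m fun d hd => ?_)
  by_contra hPd
  exact hmin d (hsub hd) ((hs d).2 ⟨htrans hd hm'.1, hPd⟩)

end Recursion

end

section

variable {α : Type*} [Nonempty α]

section TransitiveClosure

variable {E : α → α → Prop} {A : Set α}

/-- `x` is a transitive set. -/
def Trans (E : α → α → Prop) (x : α) : Prop := ∀ y, E y x → ∀ z, E z y → E z x

instance : Def1 E A (Trans E) := ⟨by unfold Trans; infer_instance⟩

/-- The transitive closure. -/
noncomputable def tc (E : α → α → Prop) (x : α) : α :=
  collect E fun z => ∀ T, Trans E T → (∀ y, E y x → E y T) → E z T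

instance : DefF1 E A (tc E) := ⟨by unfold tc; infer_instance⟩

variable [SetAxioms E]

theorem mem_irrefl (x : α) : ¬ E x x := by
  intro h
  obtain ⟨m, hm, hmin⟩ := SetAxioms.foundation (E := E) (collect E fun z => z = x)
    ⟨x, (isSet_singleton x).mem_collect.2 rfl⟩
  obtain rfl := (isSet_singleton x).mem_collect.1 hm
  exact hmin _ h hm

variable (A) in
theorem exists_trans [Replacement E A] (x : α) : ∃ T, Trans E T ∧ ∀ y, E y x → E y T := by
  obtain ⟨I, ⟨e, heI, he⟩, hI⟩ := SetAxioms.infinity (E := E)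
  obtain ⟨J, hJ⟩ := (isSet_mem I).sep A (Q := fun n => E n I ∧ Trans E n) fun _ h => h.1
  let R : α → α → Prop := fun m n => E m J ∧ E n J ∧ E m n
  have : Def2 E A R := ⟨by infer_instance⟩
  have htrans : ∀ {a b c : α}, R a b → R b c → R a c := fun {a b c} hab hbc =>
    ⟨hab.1, hbc.2.1, ((hJ c).1 hbc.2.1).2 b hbc.2.2 a hab.2.2⟩
  have hR : Recursive E A R := ⟨this, htrans,
    fun b => (isSet_mem b).sep A fun x hx => hx.2.2,
    fun P _ h => induction_of_sub (E := E) (A := A) (R := R) htrans (fun h => h.2.2) P h⟩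
  have hset (s : α) : IsSet E fun z => E z x ∨ ∃ u, E u s ∧ ∃ y, E y u ∧ E z y :=
    (isSet_mem x).or ((isSet_mem s).biUnion A (fun u z => ∃ y, E y u ∧ E z y)
      fun u _ => isSet_union u)
  obtain ⟨F, hF, hFeq⟩ := hR.exists_rec
    (fun _ s => collect E fun z => E z x ∨ ∃ u, E u s ∧ ∃ y, E y u ∧ E z y)
    (hH := ⟨by infer_instance⟩)
  have hmem (n z : α) : E z (F n) ↔ E z x ∨ ∃ m, R m n ∧ ∃ y, E y (F m) ∧ E z y := by
    rw [hFeq, (hset _).mem_collect]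
    simp only [((hR.isSet n).imageF A F).mem_collect]
    exact or_congr_right ⟨fun ⟨_, ⟨m, hm, rfl⟩, h⟩ => ⟨m, hm, h⟩,
      fun ⟨m, hm, h⟩ => ⟨_, ⟨m, hm, rfl⟩, h⟩⟩
  obtain ⟨T, hT⟩ := (isSet_mem J).biUnion A (fun n z => E z (F n)) fun n _ => isSet_mem _
  refine ⟨T, fun y hy z hz => ?_, fun y hy => ?_⟩
  · obtain ⟨n, hn, hyn⟩ := (hT y).1 hy
    obtain ⟨hnI, hnT⟩ := (hJ n).1 hn
    obtain ⟨s, hsI, hs⟩ := hI n hnI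
    have hsJ : E s J := (hJ s).2 ⟨hsI, fun y hy z hz => by
      rcases (hs y).1 hy with h | rfl
      · exact (hs z).2 (.inl (hnT y h z hz))
      · exact (hs z).2 (.inl hz)⟩
    exact (hT z).2 ⟨s, hsJ, (hmem s z).2 (.inr ⟨n, ⟨hn, hsJ, (hs n).2 (.inr rfl)⟩, y, hyn, hz⟩)⟩
  · have heJ : E e J := (hJ e).2 ⟨heI, fun y hy => (he y hy).elim⟩
    exact (hT y).2 ⟨e, heJ, (hmem e y).2 (.inl hy)⟩

variable (A) in
theorem mem_tc [Replacement E A] {x z : α} :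
    E z (tc E x) ↔ ∀ T, Trans E T → (∀ y, E y x → E y T) → E z T := by
  obtain ⟨T, hT, hx⟩ := exists_trans (E := E) A x
  exact ((isSet_mem T).sep A fun z h => h T hT hx).mem_collect

variable (A) in
theorem trans_tc [Replacement E A] (x : α) : Trans E (tc E x) := fun y hy z hz =>
  (mem_tc (E := E) A).2 fun T hT hx => hT y ((mem_tc (E := E) A).1 hy T hT hx) z hz

variable (A) in
theorem mem_tc_of_mem [Replacement E A] {x y : α} (h : E y x) : E y (tc E x) :=
  (mem_tc A).2 fun _ _ hx => hx y h

variable (A) in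
theorem tc_subset_of_mem_tc [Replacement E A] {x y z : α} (h : E y (tc E x))
    (hz : E z (tc E y)) : E z (tc E x) :=
  (mem_tc A).1 hz _ (trans_tc A x) fun w hw => trans_tc A x y h w hw

variable (A) in
theorem mem_tc_iff [Replacement E A] {x z : α} :
    E z (tc E x) ↔ E z x ∨ ∃ y, E y x ∧ E z (tc E y) := by
  constructor
  · intro h
    obtain ⟨T, hT⟩ := (isSet_mem x).or ((isSet_mem x).biUnion A (fun y z => E z (tc E y))
      fun y _ => isSet_mem _)
    refine (hT z).1 ((mem_tc A).1 h T (fun y hy w hw => (hT w).2 ?_) fun y hy => (hT y).2 (.inl hy))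
    rcases (hT y).1 hy with h | ⟨v, hv, h⟩
    · exact .inr ⟨y, h, mem_tc_of_mem A hw⟩
    · exact .inr ⟨v, hv, trans_tc A v y h w hw⟩
  · rintro (h | ⟨y, hy, h⟩)
    · exact mem_tc_of_mem A h
    · exact tc_subset_of_mem_tc A (mem_tc_of_mem A hy) h

variable (A) in
theorem mem_induction [Replacement E A] (P : α → Prop) [hP : Dfn E A fun t => P (t 0)]
    (h : ∀ b, (∀ c, E c b → P c) → P b) (b : α) : P b := by
  have : Def1 E A P := ⟨hP⟩
  refine h b ?_
  by_contra! hc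
  obtain ⟨c, hc, hPc⟩ := hc
  obtain ⟨s, hs⟩ := (isSet_mem (tc E b)).sep A (Q := fun c => E c (tc E b) ∧ ¬ P c)
    fun x hx => hx.1
  obtain ⟨m, hm, hmin⟩ := SetAxioms.foundation s ⟨c, (hs c).2 ⟨mem_tc_of_mem A hc, hPc⟩⟩
  have hm' := (hs m).1 hm
  refine hm'.2 (h m fun d hd => ?_)
  by_contra hPd
  exact hmin d hd ((hs d).2 ⟨trans_tc A b m hm'.1 d hd, hPd⟩)

theorem recursive_tc [Replacement E A] : Recursive E A fun y x => E y (tc E x) where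
  def2 := ⟨by infer_instance⟩
  trans hab hbc := tc_subset_of_mem_tc A hbc hab
  isSet b := isSet_mem _
  induction P hP h b := by
    refine h b (mem_induction (E := E) A (fun b => ∀ c, E c (tc E b) → P c) (fun b ih c hc => ?_) b)
    rcases (mem_tc_iff A).1 hc with hc | ⟨y, hy, hc⟩
    · exact h c (ih c hc)
    · exact ih y hy c hc

/-- A definable class of transitive sets linearly ordered by membership and covering the
universe. -/
structure Levels (E : α → α → Prop) (A : Set α) (Lev : α → Prop) : Prop where
  def1 : Def1 E A Lev
  trans : ∀ {v}, Lev v → Trans E v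
  trichotomy : ∀ {v w}, Lev v → Lev w → E v w ∨ v = w ∨ E w v
  exists_mem : ∀ x, ∃ v, Lev v ∧ E x v

theorem exists_levels [Replacement E A] : ∃ Lev, Levels E A Lev := by
  have hset (s : α) : IsSet E fun z => ∃ u, E u s ∧ ∀ w, E w z → E w u :=
    (isSet_mem s).biUnion A (fun u z => ∀ w, E w z → E w u) fun u _ => isSet_power u
  obtain ⟨F, hF, hFeq⟩ := (recursive_tc (E := E) (A := A)).exists_rec
    (fun _ s => collect E fun z => ∃ u, E u s ∧ ∀ w, E w z → E w u) (hH := ⟨by infer_instance⟩)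
  have hmem {x z : α} : E z (F x) ↔ ∃ y, E y (tc E x) ∧ ∀ w, E w z → E w (F y) := by
    rw [hFeq, (hset _).mem_collect]
    simp only [((isSet_mem (tc E x)).imageF A F).mem_collect]
    exact ⟨fun ⟨_, ⟨m, hm, e⟩, h⟩ => ⟨m, hm, e ▸ h⟩, fun ⟨m, hm, h⟩ => ⟨_, ⟨m, hm, rfl⟩, h⟩⟩
  have htrans (x : α) : Trans E (F x) := fun z hz w hw => by
    obtain ⟨y, hy, hzy⟩ := hmem.1 hz
    obtain ⟨y', hy', h⟩ := hmem.1 (hzy w hw)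
    exact hmem.2 ⟨y', tc_subset_of_mem_tc A hy hy', h⟩
  have hmono {x y : α} (h : E y (tc E x)) : E (F y) (F x) := hmem.2 ⟨y, h, fun _ h => h⟩
  have hsub : ∀ x z, E z x → E z (F x) := by
    refine (recursive_tc (E := E) (A := A)).induction _ ⟨by infer_instance⟩ fun x ih z hz => ?_
    have := mem_tc_of_mem A hz
    exact hmem.2 ⟨z, this, ih z this⟩
  have htri : ∀ x y, E (F x) (F y) ∨ F x = F y ∨ E (F y) (F x) := by
    refine (recursive_tc (E := E) (A := A)).induction _ ⟨by infer_instance⟩ fun x ihx => ?_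
    refine (recursive_tc (E := E) (A := A)).induction _ ⟨by infer_instance⟩ fun y ihy => ?_
    by_contra! hc
    refine hc.2.1 (mem_ext (E := E) fun z => ⟨fun hz => ?_, fun hz => ?_⟩)
    · obtain ⟨x', hx', hz⟩ := hmem.1 hz
      have : E (F x') (F y) := by
        rcases ihx x' hx' y with h | h | h
        · exact h
        · exact (hc.2.2 (h ▸ hmono hx')).elim
        · exact (hc.2.2 (htrans _ _ (hmono hx') _ h)).elim
      obtain ⟨y', hy', h⟩ := hmem.1 this
      exact hmem.2 ⟨y', hy', fun w hw => h w (hz w hw)⟩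
    · obtain ⟨y', hy', hz⟩ := hmem.1 hz
      have : E (F y') (F x) := by
        rcases ihy y' hy' with h | h | h
        · exact (hc.1 (htrans _ _ (hmono hy') _ h)).elim
        · exact (hc.1 (h ▸ hmono hy')).elim
        · exact h
      obtain ⟨x', hx', h⟩ := hmem.1 this
      exact hmem.2 ⟨x', hx', fun w hw => h w (hz w hw)⟩
  refine ⟨fun v => ∃ x, v = F x, ⟨by infer_instance⟩, ?_, ?_, fun x => ?_⟩
  · rintro _ ⟨x, rfl⟩; exact htrans x
  · rintro _ _ ⟨x, rfl⟩ ⟨y, rfl⟩; exact htri x y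
  · refine ⟨_, ⟨collect E fun z => z = x, rfl⟩, hmem.2 ⟨x, mem_tc_of_mem A ?_, hsub x⟩⟩
    exact (isSet_singleton x).mem_collect.2 rfl

end TransitiveClosure

end

section

variable {α : Type*} [Nonempty α]

section Choice

variable {E : α → α → Prop} {A : Set α}

/-- Membership restricted to `Lev`. -/
def LevMem (E : α → α → Prop) (Lev : α → Prop) (w v : α) : Prop := Lev w ∧ Lev v ∧ E w v

instance {Lev : α → Prop} [Def1 E A Lev] : Def2 E A (LevMem E Lev) :=
  ⟨by unfold LevMem; infer_instance⟩

/-- The elements satisfying `P` that lie in every level meeting `P`. -/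
noncomputable def scott (E : α → α → Prop) (Lev P : α → Prop) : α :=
  collect E fun z => P z ∧ ∀ w, Lev w → (∃ u, E u w ∧ P u) → E z w

variable [SetAxioms E] [Replacement E A] {Lev : α → Prop}

theorem Levels.recursive (hL : Levels E A Lev) : Recursive E A (LevMem E Lev) := by
  have := hL.def1
  have htrans : ∀ {a b c : α}, LevMem E Lev a b → LevMem E Lev b c → LevMem E Lev a c :=
    fun {a b c} hab hbc => ⟨hab.1, hbc.2.1, hL.trans hbc.2.1 b hbc.2.2 a hab.2.2⟩
  exact ⟨inferInstance, htrans, fun b => (isSet_mem b).sep A fun x hx => hx.2.2,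
    fun P _ h => induction_of_sub (E := E) (A := A) (R := LevMem E Lev) htrans (fun h => h.2.2) P h⟩

theorem Levels.mem_scott (hL : Levels E A Lev) {P : α → Prop} [hP : Dfn E A fun t => P (t 0)]
    {z : α} : E z (scott E Lev P) ↔ P z ∧ ∀ w, Lev w → (∃ u, E u w ∧ P u) → E z w := by
  have := hL.def1
  have : Def1 E A P := ⟨hP⟩
  refine IsSet.mem_collect ?_
  by_cases h : ∃ u, P u
  · obtain ⟨u, hu⟩ := h
    obtain ⟨v, hv, huv⟩ := hL.exists_mem u
    exact (isSet_mem v).sep A fun z hz => hz.2 v hv ⟨u, huv, hu⟩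
  · exact (isSet_mem (Classical.arbitrary α)).sep A fun z hz => (h ⟨z, hz.1⟩).elim

theorem Levels.exists_mem_scott (hL : Levels E A Lev) {P : α → Prop}
    [hP : Dfn E A fun t => P (t 0)] (h : ∃ u, P u) : ∃ z, E z (scott E Lev P) := by
  have := hL.def1
  have : Def1 E A P := ⟨hP⟩
  by_contra hne
  obtain ⟨u, hu⟩ := h
  obtain ⟨v, hv, huv⟩ := hL.exists_mem u
  refine (hL.recursive.induction (fun v => Lev v → ∀ u, E u v → ¬ P u) ⟨by infer_instance⟩
    fun v ih hv u huv hu => hne ⟨u, hL.mem_scott.2 ⟨hu, fun w hw hw' => ?_⟩⟩) v hv u huv hu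
  obtain ⟨u', hu', hPu'⟩ := hw'
  rcases hL.trichotomy hv hw with h | h | h
  · exact hL.trans hw v h u huv
  · exact h ▸ huv
  · exact (ih w ⟨hw, hv, h⟩ hw u' hu' hPu').elim

variable (A) in
theorem exists_choice (hac : SatAC Set.univ E) (c : α) :
    ∃ g, DefF1 E A g ∧ ∀ y, E y c → (∃ z, E z y) → E (g y) y := by
  simp only [SatAC, Set.mem_univ, true_and, true_implies] at hac
  have hT (y : α) : IsSet E fun p => ∃ z, E z y ∧ p = kp E y z := (isSet_mem y).imageF A (kp E y)
  obtain ⟨d, hd⟩ := (isSet_mem (E := E) c).sep A (Q := fun y => E y c ∧ ∃ z, E z y) fun _ h => h.1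
  obtain ⟨x, hx⟩ := (isSet_mem (E := E) d).imageF A fun y => collect E fun p => ∃ z, E z y ∧ p = kp E y z
  obtain ⟨h, hh⟩ := hac x
    (fun y hy => by
      obtain ⟨y, hyd, rfl⟩ := (hx _).1 hy
      obtain ⟨-, z, hz⟩ := (hd y).1 hyd
      exact ⟨_, (hT y).mem_collect.2 ⟨z, hz, rfl⟩⟩)
    (fun y y' hy hy' hz => by
      obtain ⟨y, hy, rfl⟩ := (hx _).1 hy
      obtain ⟨y', hy', rfl⟩ := (hx _).1 hy'
      obtain ⟨p, hp, hp'⟩ := hz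
      obtain ⟨z, -, rfl⟩ := (hT y).mem_collect.1 hp
      obtain ⟨z', -, e⟩ := (hT y').mem_collect.1 hp'
      rw [(kp_inj.1 e).1])
  refine ⟨fun y => iota fun z => E z y ∧ E (kp E y z) h, ⟨inferInstance⟩, fun y hy hne => ?_⟩
  obtain ⟨p, hp, hph, hu⟩ := hh _ ((hx _).2 ⟨y, (hd y).2 ⟨hy, hne⟩, rfl⟩)
  obtain ⟨z, hz, rfl⟩ := (hT y).mem_collect.1 hp
  refine (iota_spec (P := fun z => E z y ∧ E (kp E y z) h) ⟨z, ⟨hz, hph⟩, fun w hw => ?_⟩).1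
  exact (kp_inj.1 (hu (kp E y w) ((hT y).mem_collect.2 ⟨w, hw.1, rfl⟩) hw.2)).2

/-- Every set is enumerated along an initial segment of the levels. -/
theorem Levels.exists_enum (hL : Levels E A Lev) (hac : SatAC Set.univ E) (a : α) :
    ∃ v f, DefF1 E A f ∧ ∀ x, E x a → ∃ w, LevMem E Lev w v ∧ x = f w := by
  have := hL.def1
  obtain ⟨g, hg, hgy⟩ := exists_choice A hac (pow E a)
  obtain ⟨F, hF, hFeq⟩ := hL.recursive.exists_rec
    (fun _ s => g (collect E fun z => E z a ∧ ¬ E z s)) (hH := ⟨by infer_instance⟩)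
  have him (v : α) : IsSet E fun u => ∃ w, LevMem E Lev w v ∧ u = F w :=
    (hL.recursive.isSet v).imageF A F
  by_contra! hc
  have hF' {v : α} : E (F v) a ∧ ∀ w, LevMem E Lev w v → F v ≠ F w := by
    have hs : IsSet E fun z => E z a ∧ ¬ E z (collect E fun u => ∃ w, LevMem E Lev w v ∧ u = F w) :=
      (isSet_mem a).sep A fun _ h => h.1
    have := hgy (collect E fun z => E z a ∧
      ¬ E z (collect E fun u => ∃ w, LevMem E Lev w v ∧ u = F w))
      (mem_pow.2 fun w hw => (hs.mem_collect.1 hw).1) (by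
        obtain ⟨x, hx, hxF⟩ := hc v F hF
        exact ⟨x, hs.mem_collect.2 ⟨hx, fun h => by
          obtain ⟨w, hw, e⟩ := (him v).mem_collect.1 h
          exact hxF w hw e⟩⟩)
    rw [← hFeq, hs.mem_collect, (him v).mem_collect] at this
    exact ⟨this.1, fun w hw e => this.2 ⟨w, hw, e⟩⟩
  obtain ⟨s, hs⟩ := (isSet_mem (E := E) a).image A (fun x v => Lev v ∧ x = F v) fun x v v' _ h h' => by
    rcases hL.trichotomy h.1 h'.1 with e | e | e
    · exact (hF'.2 v ⟨h.1, h'.1, e⟩ (h'.2.symm.trans h.2)).elim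
    · exact e
    · exact (hF'.2 v' ⟨h'.1, h.1, e⟩ (h.2.symm.trans h'.2)).elim
  obtain ⟨v, hv, hsv⟩ := hL.exists_mem s
  exact mem_irrefl v (hL.trans hv s hsv v ((hs v).2 ⟨F v, hF'.1, hv, rfl⟩))

/-- Dependent choices along an initial segment of the levels. -/
theorem Levels.exists_dependent (hL : Levels E A Lev) (hac : SatAC Set.univ E) (v : α)
    (Φ : α → α → α → Prop) [Def3 E A Φ] (hΦ : ∀ x s, ∃ z, Φ x s z) :
    ∃ f, DefF1 E A f ∧ ∀ x, LevMem E Lev x v →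
      Φ x (collect E fun u => ∃ y, LevMem E Lev y x ∧ u = f y) (f x) := by
  have := hL.def1
  have hscott : DefF2 E A fun x s => scott E Lev (Φ x s) := ⟨by unfold scott; infer_instance⟩
  have hscott' {f g : (ℕ → α) → α} [DfnT E A f] [DfnT E A g] :
    DfnT E A fun t => scott E Lev (Φ (f t) (g t)) :=
      DefF2.app (F := fun x s => scott E Lev (Φ x s))
  have hset (x s : α) : IsSet E fun z => ∃ t, (∀ w, E w t → ∃ u, E u s ∧ E w u) ∧
      E z (scott E Lev (Φ x t)) := by
    obtain ⟨u, hu⟩ := isSet_union (E := E) s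
    refine IsSet.biUnion A ((isSet_power u).of_iff fun t => ?_)
      (fun t z => E z (scott E Lev (Φ x t))) fun t _ => isSet_mem _
    simp only [hu]
  obtain ⟨B, hB, hBeq⟩ := hL.recursive.exists_rec
    (fun x s => collect E fun z => ∃ t, (∀ w, E w t → ∃ u, E u s ∧ E w u) ∧
      E z (scott E Lev (Φ x t))) (hH := ⟨by infer_instance⟩)
  have him (F : α → α) [DefF1 E A F] (x : α) :
      IsSet E fun u => ∃ w, LevMem E Lev w x ∧ u = F w := (hL.recursive.isSet x).imageF A F
  obtain ⟨U, hU⟩ := (hL.recursive.isSet v).biUnion A (fun x z => E z (B x)) fun x _ => isSet_mem _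
  obtain ⟨g, hg, hgy⟩ := exists_choice A hac (pow E U)
  obtain ⟨f, hf, hfeq⟩ := hL.recursive.exists_rec
    (fun x s => g (scott E Lev (Φ x s))) (hH := ⟨by infer_instance⟩)
  have main : ∀ x, LevMem E Lev x v → E (f x) (B x) ∧
      Φ x (collect E fun u => ∃ y, LevMem E Lev y x ∧ u = f y) (f x) := by
    refine hL.recursive.induction _ ⟨by infer_instance⟩ fun x ih hx => ?_
    set s := collect E fun u => ∃ y, LevMem E Lev y x ∧ u = f y with hs
    have hsub : ∀ z, E z (scott E Lev (Φ x s)) → E z (B x) := fun z hz => by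
      rw [hBeq, (hset _ _).mem_collect]
      refine ⟨s, fun w hw => ?_, hz⟩
      obtain ⟨y, hy, rfl⟩ := (him f x).mem_collect.1 hw
      exact ⟨B y, (him B x).mem_collect.2 ⟨y, hy, rfl⟩, (ih y hy (hL.recursive.trans hy hx)).1⟩
    have hmem : E (f x) (scott E Lev (Φ x s)) := by
      rw [hfeq]
      refine hgy _ (mem_pow.2 fun w hw => (hU w).2 ⟨x, hx, hsub w hw⟩) ?_
      exact hL.exists_mem_scott (hΦ x s)
    exact ⟨hsub _ hmem, (hL.mem_scott.1 hmem).1⟩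
  exact ⟨f, hf, fun x hx => (main x hx).2⟩

end Choice

end

section

variable {α : Type*} [Nonempty α]

section Conditions

variable {E : α → α → Prop} {A : Set α}

/-- Inclusion. -/
def Sub (E : α → α → Prop) (x y : α) : Prop := ∀ z, E z x → E z y

instance : Def2 E A (Sub E) := ⟨by unfold Sub; infer_instance⟩

/-- `p` is well-ordered by inclusion and separates the points of its union: the sets of
predecessors of a well-order of that union. -/
structure Cond (E : α → α → Prop) (p : α) : Prop where
  wo : ∀ s, Sub E s p → (∃ z, E z s) → ∃ m, E m s ∧ ∀ z, E z s → Sub E m z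
  sep : ∀ x y u v, E u p → E x u → E v p → E y v → x ≠ y →
    ∃ w, E w p ∧ (E x w ∧ ¬ E y w ∨ ¬ E x w ∧ E y w)

instance : Def1 E A (Cond E) :=
  ⟨(inferInstance : Dfn E A fun t =>
    (∀ s, Sub E s (t 0) → (∃ z, E z s) → ∃ m, E m s ∧ ∀ z, E z s → Sub E m z) ∧
    ∀ x y u v, E u (t 0) → E x u → E v (t 0) → E y v → x ≠ y →
      ∃ w, E w (t 0) ∧ (E x w ∧ ¬ E y w ∨ ¬ E x w ∧ E y w)).of_iff
    fun _ => ⟨fun h => ⟨h.1, h.2⟩, fun h => ⟨h.1, h.2⟩⟩⟩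

/-- `q` end-extends `p`. -/
def EndExt (E : α → α → Prop) (q p : α) : Prop :=
  Sub E p q ∧ ∀ u, E u q → ¬ E u p → ∀ v, E v p → Sub E v u

instance : Def2 E A (EndExt E) := ⟨by unfold EndExt; infer_instance⟩

/-- `q` is a condition extending `p`. -/
def Stronger (E : α → α → Prop) (q p : α) : Prop := Cond E q ∧ EndExt E q p

instance : Def2 E A (Stronger E) := ⟨by unfold Stronger; infer_instance⟩

theorem EndExt.refl (p : α) : EndExt E p p := ⟨fun _ h => h, fun _ h h' => (h' h).elim⟩

theorem EndExt.trans {p q r : α} (h : EndExt E r q) (h' : EndExt E q p) : EndExt E r p :=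
  ⟨fun z hz => h.1 z (h'.1 z hz), fun u hu hup v hv => by
    by_cases huq : E u q
    · exact h'.2 u huq hup v hv
    · exact h.2 u hu huq v (h'.1 v hv)⟩

theorem Cond.refl {p : α} (h : Cond E p) : Stronger E p p := ⟨h, EndExt.refl p⟩

theorem Stronger.trans {p q r : α} (hr : Stronger E r q) (hq : Stronger E q p) :
    Stronger E r p :=
  ⟨hr.1, hr.2.trans hq.2⟩

/-- `s` is a set of pairwise comparable conditions. -/
def IsChainOf (E : α → α → Prop) (s : α) : Prop :=
  ∀ q, E q s → Cond E q ∧ ∀ r, E r s → EndExt E q r ∨ EndExt E r q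

instance : Def1 E A (IsChainOf E) := ⟨by unfold IsChainOf; infer_instance⟩

variable [SetAxioms E]

theorem IsChainOf.union (A : Set α) [Replacement E A] {s P : α} (hs : IsChainOf E s) (hP : ∀ u, E u P ↔ ∃ q, E q s ∧ E u q) :
    Cond E P ∧ ∀ q, E q s → EndExt E P q := by
  have hext (q : α) (hq : E q s) : EndExt E P q := by
    refine ⟨fun z hz => (hP z).2 ⟨q, hq, hz⟩, fun u hu huq v hv => ?_⟩
    obtain ⟨r, hr, hur⟩ := (hP u).1 hu
    rcases (hs q hq).2 r hr with h | h
    · exact (huq (h.1 u hur)).elim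
    · exact h.2 u hur huq v hv
  refine ⟨⟨fun t ht hne => ?_, fun x y u v hu hx hv hy hxy => ?_⟩, hext⟩
  · obtain ⟨u, hu⟩ := hne
    obtain ⟨q, hq, huq⟩ := (hP u).1 (ht u hu)
    obtain ⟨t', ht'⟩ := (isSet_mem t).sep A (Q := fun z => E z t ∧ E z q) fun _ h => h.1
    obtain ⟨m, hm, hmin⟩ := (hs q hq).1.wo t' (fun z hz => ((ht' z).1 hz).2)
      ⟨u, (ht' u).2 ⟨hu, huq⟩⟩
    obtain ⟨hmt, hmq⟩ := (ht' m).1 hm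
    refine ⟨m, hmt, fun z hz => ?_⟩
    by_cases hzq : E z q
    · exact hmin z ((ht' z).2 ⟨hz, hzq⟩)
    · exact (hext q hq).2 z (ht z hz) hzq m hmq
  · obtain ⟨q, hq, huq⟩ := (hP u).1 hu
    obtain ⟨r, hr, hvr⟩ := (hP v).1 hv
    rcases (hs q hq).2 r hr with h | h
    · obtain ⟨w, hw, h'⟩ := (hs q hq).1.sep x y u v huq hx (h.1 v hvr) hy hxy
      exact ⟨w, (hP w).2 ⟨q, hq, hw⟩, h'⟩
    · obtain ⟨w, hw, h'⟩ := (hs r hr).1.sep x y u v (h.1 u huq) hx hvr hy hxy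
      exact ⟨w, (hP w).2 ⟨r, hr, hw⟩, h'⟩

theorem Cond.exists_mem (A : Set α) [Replacement E A] {p : α} (hp : Cond E p) (x : α) :
    ∃ q, Stronger E q p ∧ ∃ u, E u q ∧ E x u := by
  by_cases hx : ∃ u, E u p ∧ E x u
  · exact ⟨p, hp.refl, hx⟩
  obtain ⟨U, hU⟩ := isSet_union (E := E) p
  obtain ⟨V, hV⟩ := (isSet_mem (E := E) U).or (isSet_singleton x)
  obtain ⟨q, hq⟩ := (isSet_mem p).or (isSet_pair (E := E) U V)
  have hxU : ¬ E x U := fun h => hx ((hU x).1 h)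
  have hsub (v : α) (hv : E v p) : Sub E v U := fun z hz => (hU z).2 ⟨v, hv, hz⟩
  have hUV : Sub E U V := fun z hz => (hV z).2 (.inl hz)
  have hqU : E U q := (hq U).2 (.inr (.inl rfl))
  have hqV : E V q := (hq V).2 (.inr (.inr rfl))
  have hqV' (v : α) (hv : E v q) : Sub E v V := fun z hz => by
    rcases (hq v).1 hv with h | rfl | rfl
    · exact hUV z (hsub v h z hz)
    · exact hUV z hz
    · exact hz
  refine ⟨q, ⟨⟨fun t ht hne => ?_, fun y z u v hu hy hv hz hyz => ?_⟩,
    fun z hz => (hq z).2 (.inl hz), fun u hu hup v hv => ?_⟩, V, hqV, (hV x).2 (.inr rfl)⟩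
  · obtain ⟨t', ht'⟩ := (isSet_mem t).sep A (Q := fun z => E z t ∧ E z p) fun _ h => h.1
    by_cases hne' : ∃ z, E z t'
    · obtain ⟨m, hm, hmin⟩ := hp.wo t' (fun z hz => ((ht' z).1 hz).2) hne'
      obtain ⟨hmt, hmp⟩ := (ht' m).1 hm
      refine ⟨m, hmt, fun z hz => ?_⟩
      rcases (hq z).1 (ht z hz) with h | rfl | rfl
      · exact hmin z ((ht' z).2 ⟨hz, h⟩)
      · exact hsub m hmp
      · exact fun w hw => hUV w (hsub m hmp w hw)
    · have h (z : α) (hz : E z t) : z = U ∨ z = V :=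
        ((hq z).1 (ht z hz)).resolve_left fun h => hne' ⟨z, (ht' z).2 ⟨hz, h⟩⟩
      by_cases hUt : E U t
      · refine ⟨U, hUt, fun z hz => ?_⟩
        rcases h z hz with rfl | rfl
        · exact fun _ h => h
        · exact hUV
      · obtain ⟨z, hz⟩ := hne
        refine ⟨z, hz, fun w hw => ?_⟩
        rcases h z hz with rfl | rfl
        · exact (hUt hz).elim
        · rcases h w hw with rfl | rfl
          · exact (hUt hw).elim
          · exact fun _ h => h
  · have hyV := (hV y).1 (hqV' u hu y hy)
    have hzV := (hV z).1 (hqV' v hv z hz)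
    rcases hyV with hyU | rfl
    · rcases hzV with hzU | rfl
      · obtain ⟨u', hu', hy'⟩ := (hU y).1 hyU
        obtain ⟨v', hv', hz'⟩ := (hU z).1 hzU
        obtain ⟨w, hw, h⟩ := hp.sep y z u' v' hu' hy' hv' hz' hyz
        exact ⟨w, (hq w).2 (.inl hw), h⟩
      · exact ⟨U, hqU, .inl ⟨hyU, hxU⟩⟩
    · rcases hzV with hzU | rfl
      · exact ⟨U, hqU, .inr ⟨hxU, hzU⟩⟩
      · exact (hyz rfl).elim
  · rcases (hq u).1 hu with h | rfl | rfl
    · exact (hup h).elim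
    · exact hsub v hv
    · exact fun w hw => hUV w (hsub v hv w hw)

variable [Replacement E A]

/-- Set-many definable open dense classes of conditions have dense intersection. -/
theorem exists_stronger_forall (hac : SatAC Set.univ E) (a : α) (D : α → α → Prop)
    [hD : Dfn E A fun t => D (t 0) (t 1)]
    (hopen : ∀ x p q, D x p → Stronger E q p → D x q)
    (hdense : ∀ x p, E x a → Cond E p → ∃ q, Stronger E q p ∧ D x q) {p : α} (hp : Cond E p) :
    ∃ q, Stronger E q p ∧ ∀ x, E x a → D x q := by
  have : Def2 E A D := ⟨hD⟩
  obtain ⟨Lev, hL⟩ := exists_levels (E := E) (A := A)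
  have := hL.def1
  obtain ⟨v, f, hf, hfa⟩ := hL.exists_enum hac a
  have hbound (s : α) (hs : IsChainOf E s) (hsp : ∀ q, E q s → EndExt E q p) :
      ∃ q, Stronger E q p ∧ ∀ r, E r s → EndExt E q r := by
    obtain ⟨s', hs'⟩ := (isSet_mem s).or (isSet_singleton (E := E) p)
    obtain ⟨P, hP⟩ := isSet_union (E := E) s'
    have hc : IsChainOf E s' := by
      intro q hq
      rcases (hs' q).1 hq with hq | rfl
      · refine ⟨(hs q hq).1, fun r hr => ?_⟩
        rcases (hs' r).1 hr with hr | rfl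
        · exact (hs q hq).2 r hr
        · exact .inl (hsp q hq)
      · refine ⟨hp, fun r hr => ?_⟩
        rcases (hs' r).1 hr with hr | rfl
        · exact .inr (hsp r hr)
        · exact .inl (EndExt.refl _)
    have hu := hc.union A hP
    exact ⟨P, ⟨hu.1, hu.2 p ((hs' p).2 (.inr rfl))⟩, fun r hr => hu.2 r ((hs' r).2 (.inl hr))⟩
  let Φ : α → α → α → Prop := fun w s z =>
    (IsChainOf E s ∧ ∀ q, E q s → EndExt E q p) →
      Stronger E z p ∧ (∀ r, E r s → EndExt E z r) ∧ (E (f w) a → D (f w) z)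
  have hΦd : Def3 E A Φ := ⟨by infer_instance⟩
  have hΦ (w s : α) : ∃ z, Φ w s z := by
    by_cases hs : IsChainOf E s ∧ ∀ q, E q s → EndExt E q p
    · obtain ⟨q, hqp, hq⟩ := hbound s hs.1 hs.2
      by_cases hw : E (f w) a
      · obtain ⟨r, hrq, hr⟩ := hdense _ q hw hqp.1
        exact ⟨r, fun _ => ⟨hrq.trans hqp, fun r' hr' => hrq.2.trans (hq r' hr'), fun _ => hr⟩⟩
      · exact ⟨q, fun _ => ⟨hqp, hq, fun h => (hw h).elim⟩⟩
    · exact ⟨p, fun h => (hs h).elim⟩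
  obtain ⟨h, hh, hhΦ⟩ := hL.exists_dependent hac v Φ hΦ
  have him (x : α) : IsSet E fun u => ∃ y, LevMem E Lev y x ∧ u = h y :=
    (hL.recursive.isSet x).imageF A h
  have hchain (x : α) (hx : ∀ y, LevMem E Lev y x →
      Stronger E (h y) p ∧ ∀ z, LevMem E Lev z y → EndExt E (h y) (h z)) :
      IsChainOf E (collect E fun u => ∃ y, LevMem E Lev y x ∧ u = h y) ∧
        ∀ q, E q (collect E fun u => ∃ y, LevMem E Lev y x ∧ u = h y) → EndExt E q p := by
    refine ⟨fun q hq => ?_, fun q hq => ?_⟩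
    · obtain ⟨y, hy, rfl⟩ := (him x).mem_collect.1 hq
      refine ⟨(hx y hy).1.1, fun r hr => ?_⟩
      obtain ⟨z, hz, rfl⟩ := (him x).mem_collect.1 hr
      rcases hL.trichotomy hy.1 hz.1 with e | rfl | e
      · exact .inr ((hx z hz).2 y ⟨hy.1, hz.1, e⟩)
      · exact .inl (EndExt.refl _)
      · exact .inl ((hx y hy).2 z ⟨hz.1, hy.1, e⟩)
    · obtain ⟨y, hy, rfl⟩ := (him x).mem_collect.1 hq
      exact (hx y hy).1.2
  have main : ∀ x, LevMem E Lev x v → (Stronger E (h x) p ∧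
      ∀ z, LevMem E Lev z x → EndExt E (h x) (h z)) := by
    refine hL.recursive.induction _ ⟨by infer_instance⟩ fun x ih hx => ?_
    obtain ⟨h₁, h₂, -⟩ := hhΦ x hx
      (hchain x fun y hy => ih y hy (hL.recursive.trans hy hx))
    exact ⟨h₁, fun z hz => h₂ _ ((him x).mem_collect.2 ⟨z, hz, rfl⟩)⟩
  obtain ⟨q, hqp, hq⟩ := hbound _ (hchain v main).1 (hchain v main).2
  refine ⟨q, hqp, fun x hx => ?_⟩
  obtain ⟨w, hw, rfl⟩ := hfa x hx
  obtain ⟨-, -, h₃⟩ := hhΦ w hw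
    (hchain w fun y hy => main y (hL.recursive.trans hy hw))
  exact hopen _ _ _ (h₃ hx) ⟨hqp.1, hq _ ((him v).mem_collect.2 ⟨w, hw, rfl⟩)⟩

end Conditions

end

section

section Forcing

variable {α : Type*} [Nonempty α] {E : α → α → Prop}

/-- The condition `p` forces `φ` about the union of a generic filter. -/
def Forces (E : α → α → Prop) : DFm α → α → (ℕ → α) → Prop
  | .mem a b, _, t => E (a.eval t) (b.eval t)
  | .cls a, p, t => ∀ q, Stronger E q p → ∃ r, Stronger E r q ∧ E (a.eval t) r
  | .eq a b, _, t => a.eval t = b.eval t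
  | .fal, _, _ => False
  | .imp φ ψ, p, t => ∀ q, Stronger E q p → Forces E φ q t → Forces E ψ q t
  | .all φ, p, t => ∀ x, Forces E φ p (scons x t)

theorem Forces.mono {φ : DFm α} : ∀ {p q : α} {t : ℕ → α}, Forces E φ p t → Stronger E q p →
    Forces E φ q t := by
  induction φ with
  | mem a b => exact fun h _ => h
  | cls a => exact fun h hq r hr => h r (hr.trans hq)
  | eq a b => exact fun h _ => h
  | fal => exact fun h _ => h
  | imp φ ψ _ _ => exact fun h hq r hr => h r (hr.trans hq)
  | all φ ih => exact fun h hq x => ih (h x) hq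

theorem Forces.of_dense {φ : DFm α} : ∀ {p : α} {t : ℕ → α}, Cond E p →
    (∀ q, Stronger E q p → ∃ r, Stronger E r q ∧ Forces E φ r t) → Forces E φ p t := by
  induction φ with
  | mem a b => exact fun hp h => (h _ hp.refl).choose_spec.2
  | cls a =>
    intro p t hp h q hq
    obtain ⟨r, hr, hf⟩ := h q hq
    obtain ⟨s, hs, hs'⟩ := hf r hr.1.refl
    exact ⟨s, hs.trans hr, hs'⟩
  | eq a b => exact fun hp h => (h _ hp.refl).choose_spec.2
  | fal => exact fun hp h => (h _ hp.refl).choose_spec.2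
  | imp φ ψ _ ih =>
    intro p t hp h q hq hφ
    refine ih hq.1 fun r hr => ?_
    obtain ⟨s, hs, hf⟩ := h r (hr.trans hq)
    exact ⟨s, hs, hf s hs.1.refl (hφ.mono (hs.trans hr))⟩
  | all φ ih =>
    intro p t hp h x
    refine ih hp fun q hq => ?_
    obtain ⟨r, hr, hf⟩ := h q hq
    exact ⟨r, hr, hf x⟩

theorem DTm.dfnT_eval {A : Set α} (a : DTm α) : DfnT E A a.eval := by
  cases a with
  | var n => exact DfnT.var n
  | cst c => exact DfnT.const c

instance {A : Set α} (a : DTm α) : DfnT E A fun t => a.eval fun n => t (n + 1) :=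
  a.dfnT_eval.rename _

theorem dfn_forces {A : Set α} (φ : DFm α) :
    Dfn E A fun t => Forces E φ (t 0) fun n => t (n + 1) := by
  induction φ with
  | mem a b => unfold Forces; infer_instance
  | cls a =>
    unfold Forces
    have := (inferInstance : DfnT E A fun t => a.eval fun n => t (n + 1)).rename fun n =>
      if n = 0 then 0 else n + 2
    simp only [Nat.add_eq_zero_iff, one_ne_zero, and_false, if_false] at this
    infer_instance
  | eq a b => unfold Forces; infer_instance
  | fal => unfold Forces; infer_instance
  | imp φ ψ ih₁ ih₂ =>
    unfold Forces
    have h₁ := ih₁.rename fun n => if n = 0 then 0 else n + 1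
    have h₂ := ih₂.rename fun n => if n = 0 then 0 else n + 1
    simp only [Nat.add_eq_zero_iff, one_ne_zero, and_false, if_false, if_true] at h₁ h₂
    infer_instance
  | all φ ih =>
    unfold Forces
    have h := ih.rename fun n => if n = 0 then 1 else if n = 1 then 0 else n
    have : Dfn E A fun t => Forces E φ (t 1) (scons (t 0) fun n => t (n + 2)) := by
      refine h.of_iff fun t => ?_
      simp only [if_true]
      congr! 1
      funext n
      cases n <;> simp [scons]
    infer_instance

/-- A decreasing sequence of conditions meets the class of conditions deciding each predicate
of a countable family. -/
theorem exists_generic (hne : ∃ p, Cond E p) {ι : Type*} [Countable ι] (P : ι → α → Prop) :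
    ∃ p : ℕ → α, (∀ n, Cond E (p n)) ∧ (∀ m n, m ≤ n → Stronger E (p n) (p m)) ∧
      ∀ i, ∃ n, P i (p n) ∨ ∀ r, Stronger E r (p n) → ¬ P i r := by
  classical
  obtain ⟨p₀, hp₀⟩ := hne
  cases isEmpty_or_nonempty ι with
  | inl h => exact ⟨fun _ => p₀, fun _ => hp₀, fun _ _ _ => hp₀.refl, fun i => h.elim i⟩
  | inr h =>
    obtain ⟨e, he⟩ := exists_surjective_nat ι
    have step (n : ℕ) (p : {p // Cond E p}) : ∃ q : {p // Cond E p}, Stronger E q p ∧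
        (P (e n) q ∨ ∀ r, Stronger E r q → ¬ P (e n) r) := by
      by_cases hq : ∃ q, Stronger E q p ∧ P (e n) q
      · obtain ⟨q, hq, hP⟩ := hq
        exact ⟨⟨q, hq.1⟩, hq, .inl hP⟩
      · exact ⟨p, p.2.refl, .inr fun r hr hP => hq ⟨r, hr, hP⟩⟩
    choose f hf hfP using step
    let s : ℕ → {p // Cond E p} := fun n => Nat.rec ⟨p₀, hp₀⟩ (fun n p => f n p) n
    refine ⟨fun n => (s n).1, fun n => (s n).2, fun m n hmn => ?_, fun i => ?_⟩
    · induction hmn with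
      | refl => exact (s m).2.refl
      | step _ ih => exact (hf _ _).trans ih
    · obtain ⟨n, rfl⟩ := he i
      exact ⟨n + 1, hfP n (s n)⟩

/-- The union of a sequence of sets. -/
def seqUnion (E : α → α → Prop) (p : ℕ → α) : Set α := {x | ∃ n, E x (p n)}

/-- A sequence deciding every formula satisfies the truth lemma. -/
theorem eval_seqUnion_iff {p : ℕ → α} (hp : ∀ m n, m ≤ n → Stronger E (p n) (p m))
    (hcls : ∀ x, ∃ n, E x (p n) ∨ ∀ r, Stronger E r (p n) → ¬ E x r)
    (hdec : ∀ (φ : DFm α) (l : List α), ∃ n,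
      Forces E φ (p n) (l.getD · (Classical.arbitrary α)) ∨
      ∀ r, Stronger E r (p n) → ¬ Forces E φ r (l.getD · (Classical.arbitrary α)))
    (hall : ∀ (φ : DFm α) (l : List α), ∃ n,
      (∃ x, ∀ r, Stronger E r (p n) →
        ¬ Forces E φ r ((x :: l).getD · (Classical.arbitrary α))) ∨
      ∀ r, Stronger E r (p n) → ¬ ∃ x, ∀ s, Stronger E s r →
        ¬ Forces E φ s ((x :: l).getD · (Classical.arbitrary α))) (φ : DFm α) :
    ∀ l : List α, φ.eval E (seqUnion E p) (l.getD · (Classical.arbitrary α)) ↔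
      ∃ n, Forces E φ (p n) (l.getD · (Classical.arbitrary α)) := by
  have hc (n : ℕ) : Cond E (p n) := (hp n n le_rfl).1
  induction φ with
  | mem a b => intro l; simp [DFm.eval, Forces]
  | cls a =>
    intro l
    constructor
    · rintro ⟨n, hn⟩
      exact ⟨n, fun q hq => ⟨q, hq.1.refl, hq.2.1 _ hn⟩⟩
    · rintro ⟨n, hn⟩
      obtain ⟨m, h | h⟩ := hcls (a.eval (l.getD · (Classical.arbitrary α)))
      · exact ⟨m, h⟩
      · obtain ⟨r, hr, hr'⟩ := hn _ (hp n (max m n) (le_max_right _ _))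
        exact (h r (hr.trans (hp m _ (le_max_left _ _))) hr').elim
  | eq a b => intro l; simp [DFm.eval, Forces]
  | fal => intro l; simp [DFm.eval, Forces]
  | imp φ ψ ih₁ ih₂ =>
    intro l
    simp only [DFm.eval, ih₁, ih₂]
    constructor
    · intro h
      obtain ⟨n, hn | hn⟩ := hdec φ l
      · obtain ⟨m, hm⟩ := h ⟨n, hn⟩
        exact ⟨m, fun q hq _ => hm.mono hq⟩
      · exact ⟨n, fun q hq hφ => (hn q hq hφ).elim⟩
    · rintro ⟨n, hn⟩ ⟨m, hm⟩
      exact ⟨max m n, hn _ (hp _ _ (le_max_right _ _)) (hm.mono (hp _ _ (le_max_left _ _)))⟩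
  | all φ ih =>
    intro l
    have hl (x : α) : scons x (l.getD · (Classical.arbitrary α)) =
        ((x :: l).getD · (Classical.arbitrary α)) := by
      funext n
      cases n <;> simp [scons]
    simp only [DFm.eval, Forces, hl, ih]
    constructor
    · intro h
      obtain ⟨n, ⟨x, hx⟩ | hn⟩ := hall φ l
      · obtain ⟨m, hm⟩ := h x
        exact (hx _ (hp _ _ (le_max_right m n)) (hm.mono (hp _ _ (le_max_left m n)))).elim
      · refine ⟨n, fun x => Forces.of_dense (hc n) fun q hq => ?_⟩
        by_contra hcon
        exact hn q hq ⟨x, fun s hs hs' => hcon ⟨s, hs, hs'⟩⟩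
    · rintro ⟨n, hn⟩ x
      exact ⟨n, hn x⟩

/-- A definable linear order of the universe with bounded initial segments and least elements
for nonempty sets. -/
structure WellOrd (E : α → α → Prop) (A : Set α) (lt : α → α → Prop) : Prop where
  def2 : Def2 E A lt
  irrefl : ∀ x, ¬ lt x x
  trans : ∀ {x y z}, lt x y → lt y z → lt x z
  trichotomy : ∀ x y, lt x y ∨ x = y ∨ lt y x
  exists_min : ∀ d, (∃ z, E z d) → ∃ m, E m d ∧ ∀ z, E z d → ¬ lt z m
  exists_bound : ∀ a, ∃ d, ∀ b, lt b a → E b d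

/-- A decreasing sequence of conditions whose union covers the universe codes a well-order. -/
theorem wellOrd_seqUnion [SetAxioms E] [Replacement E ∅] {p : ℕ → α}
    (hp : ∀ m n, m ≤ n → Stronger E (p n) (p m)) (hcov : ∀ x, ∃ n u, E u (p n) ∧ E x u) :
    WellOrd E (seqUnion E p)
      fun x y => ∃ u, u ∈ seqUnion E p ∧ E x u ∧ ¬ E y u := by
  have hc (n : ℕ) : Cond E (p n) := (hp n n le_rfl).1
  have hcomp {u v : α} (hu : u ∈ seqUnion E p) (hv : v ∈ seqUnion E p) : Sub E u v ∨ Sub E v u := by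
    obtain ⟨m, hm⟩ := hu
    obtain ⟨n, hn⟩ := hv
    obtain ⟨b, hb⟩ := isSet_pair (E := E) u v
    have hm' := (hp _ _ (le_max_left m n)).2.1 _ hm
    have hn' := (hp _ _ (le_max_right m n)).2.1 _ hn
    obtain ⟨w, hw, hmin⟩ := (hc (max m n)).wo b
      (fun z hz => by rcases (hb z).1 hz with rfl | rfl <;> assumption) ⟨u, (hb u).2 (.inl rfl)⟩
    rcases (hb w).1 hw with rfl | rfl
    · exact .inl (hmin v ((hb v).2 (.inr rfl)))
    · exact .inr (hmin u ((hb u).2 (.inl rfl)))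
  have hG : Def1 E (seqUnion E p) (· ∈ seqUnion E p) := Def1.cls
  refine ⟨⟨?_⟩, ?_, ?_, ?_, ?_, ?_⟩
  · exact (inferInstance : Dfn E (seqUnion E p) fun t =>
      ∃ u, (· ∈ seqUnion E p) u ∧ E (t 0) u ∧ ¬ E (t 1) u)
  · rintro x ⟨u, -, h, h'⟩
    exact h' h
  · rintro x y z ⟨u, hu, hxu, hyu⟩ ⟨v, hv, hyv, hzv⟩
    rcases hcomp hu hv with h | h
    · exact ⟨v, hv, h x hxu, hzv⟩
    · exact (hyu (h y hyv)).elim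
  · intro x y
    by_cases hxy : x = y
    · exact .inr (.inl hxy)
    obtain ⟨m, u, hu, hx⟩ := hcov x
    obtain ⟨n, v, hv, hy⟩ := hcov y
    obtain ⟨w, hw, h | h⟩ := (hc (max m n)).sep x y u v ((hp _ _ (le_max_left m n)).2.1 _ hu) hx
      ((hp _ _ (le_max_right m n)).2.1 _ hv) hy hxy
    · exact .inl ⟨w, ⟨_, hw⟩, h⟩
    · exact .inr (.inr ⟨w, ⟨_, hw⟩, h.2, h.1⟩)
  · rintro d ⟨z, hz⟩
    obtain ⟨n, u, hu, hzu⟩ := hcov z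
    obtain ⟨t, ht⟩ := (isSet_mem (E := E) (p n)).sep ∅
      (Q := fun u => E u (p n) ∧ ∃ z, E z d ∧ E z u) fun _ h => h.1
    obtain ⟨m, hm, hmin⟩ := (hc n).wo t (fun v hv => ((ht v).1 hv).1) ⟨u, (ht u).2 ⟨hu, z, hz, hzu⟩⟩
    obtain ⟨hmn, x, hxd, hxm⟩ := (ht m).1 hm
    refine ⟨x, hxd, ?_⟩
    rintro y hyd ⟨v, ⟨k, hk⟩, hyv, hxv⟩
    by_cases hvn : E v (p n)
    · exact hxv (hmin v ((ht v).2 ⟨hvn, y, hyd, hyv⟩) x hxm)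
    · exact hxv ((hp _ _ (le_max_left n k)).2.2 v
        ((hp _ _ (le_max_right n k)).2.1 _ hk) hvn m hmn x hxm)
  · intro y
    obtain ⟨n, w, hw, hy⟩ := hcov y
    refine ⟨w, ?_⟩
    rintro z ⟨u, hu, hz, hyu⟩
    rcases hcomp hu ⟨n, hw⟩ with h | h
    · exact h z hz
    · exact (hyu (h y hy)).elim

/-- Forcing of a formula about two elements. -/
def ForcesPair (E : α → α → Prop) (ψ : DFm α) (z y q : α) : Prop :=
  Forces E ψ q (([z, y] : List α).getD · (Classical.arbitrary α))

instance {A : Set α} (ψ : DFm α) : Def3 E A (ForcesPair E ψ) := by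
  refine ⟨((dfn_forces ψ).subst fun n => if n = 0 then .var 2 else if n = 1 then .var 0 else
    if n = 2 then .var 1 else .cst (Classical.arbitrary α)).of_iff fun t => ?_⟩
  unfold ForcesPair
  simp only [if_true]
  congr! 1
  funext n
  match n with
  | 0 => simp [DTm.eval]
  | 1 => simp [DTm.eval]
  | n + 2 => simp [DTm.eval]

/-- Over a countable model of choice, a class coding a well-order and preserving Replacement can
be chosen so that a given nondefinable class stays nondefinable. -/
theorem exists_wellOrd_not_def1 [Countable α] [SetAxioms E] [Replacement E ∅]
    (hac : SatAC Set.univ E) {X : Set α} (hX : ¬ Def1 E ∅ (· ∈ X)) :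
    ∃ A, Replacement E A ∧ ¬ Def1 E A (· ∈ X) ∧ ∃ lt, WellOrd E A lt := by
  let d := Classical.arbitrary α
  have hne : ∃ p, Cond E p := by
    obtain ⟨I, ⟨e, -, he⟩, -⟩ := SetAxioms.infinity (E := E)
    exact ⟨e, fun s hs ⟨z, hz⟩ => (he z (hs z hz)).elim, fun x y u v hu => (he u hu).elim⟩
  let B : DFm α → α → α → Prop := fun ψ z q =>
    (∃ y, ForcesPair E ψ z y q) ∨
      ∀ y r, Stronger E r q → ¬ ForcesPair E ψ z y r
  let P : (α ⊕ DFm α × List α) ⊕ ((DFm α × List α) ⊕ (DFm α ⊕ (α ⊕ DFm α × α))) → α → Prop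
    | .inl (.inl x), q => E x q
    | .inl (.inr (φ, l)), q => Forces E φ q (l.getD · d)
    | .inr (.inl (φ, l)), q => ∃ x, ∀ r, Stronger E r q → ¬ Forces E φ r ((x :: l).getD · d)
    | .inr (.inr (.inl φ)), q => ∃ x, (x ∉ X ∧ Forces E φ q (([x] : List α).getD · d)) ∨
        (x ∈ X ∧ ∀ r, Stronger E r q → ¬ Forces E φ r (([x] : List α).getD · d))
    | .inr (.inr (.inr (.inl x))), q => ∃ u, E u q ∧ E x u
    | .inr (.inr (.inr (.inr (ψ, a)))), q => ∀ z, E z a → B ψ z q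
  obtain ⟨p, hc, hp, hP⟩ := exists_generic hne P
  have truth := eval_seqUnion_iff hp (fun x => hP (.inl (.inl x)))
    (fun φ l => hP (.inl (.inr (φ, l)))) (fun φ l => hP (.inr (.inl (φ, l))))
  have hcov (x : α) : ∃ n u, E u (p n) ∧ E x u := by
    obtain ⟨n, h | h⟩ := hP (.inr (.inr (.inr (.inl x))))
    · exact ⟨n, h⟩
    · obtain ⟨q, hq, hx⟩ := (hc n).exists_mem ∅ x
      exact (h q hq hx).elim
  refine ⟨seqUnion E p, ⟨fun R hR hfun a => ?_⟩, fun h => ?_, _, wellOrd_seqUnion hp hcov⟩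
  · obtain ⟨ψ, hRψ⟩ := hR.out.out
    have hRψ' (z y : α) : R z y ↔ ∃ n, ForcesPair E ψ z y (p n) :=
      (hRψ (([z, y] : List α).getD · d)).trans (truth ψ [z, y])
    obtain ⟨n, h⟩ : ∃ n, ∀ z, E z a → B ψ z (p n) := by
      obtain ⟨n, h | h⟩ := hP (.inr (.inr (.inr (.inr (ψ, a)))))
      · exact ⟨n, h⟩
      · obtain ⟨q, hq, hz⟩ := exists_stronger_forall (A := ∅) hac a (B ψ)
          (hD := by dsimp only [B]; infer_instance)
          (fun z q r hB hr => hB.imp (fun ⟨y, hy⟩ => ⟨y, hy.mono hr⟩)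
            fun hy y s hs => hy y s (hs.trans hr))
          (fun z q _ hq => by
            by_cases hz : ∃ y r, Stronger E r q ∧ ForcesPair E ψ z y r
            · obtain ⟨y, r, hr, hy⟩ := hz
              exact ⟨r, hr, .inl ⟨y, hy⟩⟩
            · exact ⟨q, hq.refl, .inr fun y r hr hy => hz ⟨y, r, hr, hy⟩⟩) (hc n)
        exact (h q hq hz).elim
    have hRn {z y : α} (hz : E z a) :
        R z y ↔ ForcesPair E ψ z y (p n) := by
      refine ⟨fun hR => ?_, fun hf => (hRψ' z y).2 ⟨n, hf⟩⟩
      obtain ⟨m, hm⟩ := (hRψ' z y).1 hR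
      rcases h z hz with ⟨y', hy'⟩ | h
      · rwa [hfun z y y' hR ((hRψ' z y').2 ⟨n, hy'⟩)]
      · exact (h y _ (hp _ _ (le_max_right m n)) (hm.mono (hp _ _ (le_max_left m n)))).elim
    obtain ⟨b, hb⟩ := (isSet_mem (E := E) a).image ∅
      (fun z y => ForcesPair E ψ z y (p n))
      fun z y y' hz h h' => hfun z y y' ((hRn hz).2 h) ((hRn hz).2 h')
    exact ⟨b, fun y => (hb y).trans (exists_congr fun z => and_congr_right fun hz => (hRn hz).symm)⟩
  · obtain ⟨φ, hφ⟩ := h.out.out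
    have hφ' (x : α) : x ∈ X ↔ ∃ n, Forces E φ (p n) (([x] : List α).getD · d) :=
      (hφ (([x] : List α).getD · d)).trans (truth φ [x])
    obtain ⟨n, ⟨x, ⟨hx, hf⟩ | ⟨hx, hf⟩⟩ | h⟩ := hP (.inr (.inr (.inl φ)))
    · exact hx ((hφ' x).2 ⟨n, hf⟩)
    · obtain ⟨m, hm⟩ := (hφ' x).1 hx
      exact hf _ (hp _ _ (le_max_right m n)) (hm.mono (hp _ _ (le_max_left m n)))
    · refine hX ⟨((dfn_forces φ).subst fun k => if k = 0 then .cst (p n) else if k = 1 then .var 0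
        else .cst d).of_iff fun t => ?_⟩
      trans Forces E φ (p n) (([t 0] : List α).getD · d)
      · constructor
        · intro hx
          refine Forces.of_dense (hc n) fun q hq => ?_
          by_contra hcon
          exact h q hq ⟨_, .inr ⟨hx, fun r hr hf => hcon ⟨r, hr, hf⟩⟩⟩
        · intro hf
          by_contra hx
          exact h _ (hc n).refl ⟨_, .inl ⟨hx, hf⟩⟩
      · simp only [if_true]
        congr! 1
        funext k
        match k with
        | 0 => simp [DTm.eval]
        | k + 1 => simp [DTm.eval]

end Forcing

end

section GlobalChoice

variable {α : Type*} [Nonempty α] {E : α → α → Prop} {A : Set α}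

theorem isOrdIn_iff {x : α} :
    IsOrdIn Set.univ E x ↔ Trans E x ∧ ∀ y, E y x → Trans E y := by
  simp [IsOrdIn, IsTransIn, Trans]

instance : Def1 E A (IsOrdIn Set.univ E) := by
  refine ⟨?_⟩
  simp only [isOrdIn_iff]
  infer_instance

theorem IsOrdIn.of_mem {x y : α} (hx : IsOrdIn Set.univ E x) (h : E y x) :
    IsOrdIn Set.univ E y := by
  rw [isOrdIn_iff] at hx ⊢
  exact ⟨hx.2 y h, fun z hz => hx.2 z (hx.1 y h z hz)⟩

/-- The class of pairs satisfying `R`. -/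
def graph (E : α → α → Prop) (R : α → α → Prop) : Set α := {p | ∃ x y, p = kp E x y ∧ R x y}

theorem graph_mem_defClasses {R : α → α → Prop} [Def2 E A R] : graph E R ∈ defClasses E A :=
  ⟨(inferInstance : Dfn E A fun t => ∃ x y, t 0 = kp E x y ∧ R x y)⟩

variable [SetAxioms E]

theorem pairIn_graph {R : α → α → Prop} {x y : α} : PairIn Set.univ E (graph E R) x y ↔ R x y := by
  constructor
  · rintro ⟨p, ⟨x', y', rfl, h⟩, h'⟩
    obtain ⟨rfl, rfl⟩ := kp_inj.1 (isKPair_iff_eq.1 h')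
    exact h
  · exact fun h => ⟨_, ⟨x, y, rfl, h⟩, isKPair_iff_eq.2 rfl⟩

theorem isClassRel_graph (R : α → α → Prop) : IsClassRel Set.univ E (graph E R) := by
  rintro p ⟨x, y, rfl, -⟩
  exact ⟨x, y, trivial, trivial, isKPair_iff_eq.2 rfl⟩

theorem WellOrd.isGWO {lt : α → α → Prop} (h : WellOrd E A lt) :
    IsGWO Set.univ E (graph E lt) := by
  refine ⟨isClassRel_graph lt, ?_, ?_, ?_, ?_, ?_⟩ <;>
    simp only [pairIn_graph, Set.mem_univ, true_implies, true_and]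
  · exact h.irrefl
  · exact fun x y z => h.trans
  · exact fun x y => by have := h.trichotomy x y; tauto
  · exact h.exists_min
  · exact h.exists_bound

theorem IsGWO.wellOrd {W : Set α} (h : IsGWO Set.univ E W) (hW : W ∈ defClasses E A) :
    WellOrd E A (PairIn Set.univ E W) := by
  have : Def1 E A (· ∈ W) := hW
  obtain ⟨-, h₁, h₂, h₃, h₄, h₅⟩ := h
  simp only [Set.mem_univ, true_implies, true_and] at h₁ h₂ h₃ h₄ h₅
  exact ⟨def2_pairIn, h₁, h₂ _ _ _, fun x y => by have := h₃ x y; tauto, h₄, h₅⟩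

theorem IsOrdIn.trichotomy (A : Set α) [Replacement E A] (x y : α) : IsOrdIn Set.univ E x → IsOrdIn Set.univ E y →
    E x y ∨ x = y ∨ E y x := by
  refine mem_induction (E := E) A (fun x => ∀ y, IsOrdIn Set.univ E x → IsOrdIn Set.univ E y →
    E x y ∨ x = y ∨ E y x) (fun x ihx y => ?_) x y
  refine mem_induction (E := E) A (fun y => IsOrdIn Set.univ E x → IsOrdIn Set.univ E y →
    E x y ∨ x = y ∨ E y x) (fun y ihy hx hy => ?_) y
  by_contra! hcon
  obtain ⟨hxy, hne, hyx⟩ := hcon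
  refine hne (mem_ext (E := E) fun z => ⟨fun hz => ?_, fun hz => ?_⟩)
  · rcases ihx z hz y (hx.of_mem hz) hy with h | rfl | h
    · exact h
    · exact (hyx hz).elim
    · exact (hyx ((isOrdIn_iff.1 hx).1 z hz y h)).elim
  · rcases ihy z hz hx (hy.of_mem hz) with h | rfl | h
    · exact (hxy ((isOrdIn_iff.1 hy).1 z hz x h)).elim
    · exact (hxy hz).elim
    · exact h

variable [Replacement E A]

theorem WellOrd.recursive {lt : α → α → Prop} (h : WellOrd E A lt) : Recursive E A lt := by
  have := h.def2
  have hs (b : α) : IsSet E (lt · b) := by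
    obtain ⟨d, hd⟩ := h.exists_bound b
    exact (isSet_mem d).sep A hd
  refine ⟨h.def2, h.trans, hs, fun P hP ih b => ?_⟩
  by_contra hb
  obtain ⟨s, hs⟩ := ((hs b).or (isSet_singleton b)).sep A
    (Q := fun c => (lt c b ∨ c = b) ∧ ¬ P c) fun _ h => h.1
  obtain ⟨m, hm, hmin⟩ := h.exists_min s ⟨b, (hs b).2 ⟨.inr rfl, hb⟩⟩
  obtain ⟨hmb, hmP⟩ := (hs m).1 hm
  refine hmP (ih m fun c hc => ?_)
  by_contra hcP
  refine hmin c ((hs c).2 ⟨.inl ?_, hcP⟩) hc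
  rcases hmb with hmb | rfl
  · exact h.trans hc hmb
  · exact hc

theorem WellOrd.globalChoice {lt : α → α → Prop} (h : WellOrd E A lt) :
    GlobalChoice Set.univ E (defClasses E A) := by
  have := h.def2
  obtain ⟨F, hF, hFrec⟩ := h.recursive.exists_rec (fun _ s => s) (hH := ⟨by infer_instance⟩)
  have hmem {z b : α} : E z (F b) ↔ ∃ c, lt c b ∧ z = F c := by
    rw [hFrec b]
    exact ((h.recursive.isSet b).imageF A F).mem_collect
  have hlt {c b : α} (hc : lt c b) : E (F c) (F b) := hmem.2 ⟨c, hc, rfl⟩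
  have hinj {b c : α} (e : F b = F c) : b = c := by
    rcases h.trichotomy b c with hbc | hbc | hbc
    · exact (mem_irrefl (E := E) _ (e ▸ hlt hbc)).elim
    · exact hbc
    · exact (mem_irrefl (E := E) _ (e ▸ hlt hbc)).elim
  have htrans (b : α) : Trans E (F b) := by
    intro y hy z hz
    obtain ⟨c, hc, rfl⟩ := hmem.1 hy
    obtain ⟨d, hd, rfl⟩ := hmem.1 hz
    exact hlt (h.trans hd hc)
  have hord (b : α) : IsOrdIn Set.univ E (F b) := by
    refine isOrdIn_iff.2 ⟨htrans b, fun y hy => ?_⟩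
    obtain ⟨c, -, rfl⟩ := hmem.1 hy
    exact htrans c
  have hsurj (y : α) : IsOrdIn Set.univ E y → ∃ b, y = F b := by
    refine mem_induction (E := E) A (fun y => IsOrdIn Set.univ E y → ∃ b, y = F b)
      (fun y ih hy => ?_) y
    have hex : ∃ b, ¬ E (F b) y := by
      by_contra! hall
      obtain ⟨V, hV⟩ := (isSet_mem (E := E) y).image A (fun z b => z = F b)
        fun z b c _ hb hc => hinj (hb.symm.trans hc)
      exact mem_irrefl (E := E) V ((hV V).2 ⟨_, hall V, rfl⟩)
    obtain ⟨b, hb, hmin⟩ : ∃ b, ¬ E (F b) y ∧ ∀ c, lt c b → E (F c) y := by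
      by_contra! hcon
      obtain ⟨b, hb⟩ := hex
      refine hb (h.recursive.induction (fun b => E (F b) y) ⟨by infer_instance⟩ (fun b ih => ?_) b)
      by_contra hb
      obtain ⟨c, hc, hc'⟩ := hcon b hb
      exact hc' (ih c hc)
    refine ⟨b, mem_ext (E := E) fun z => ⟨fun hz => ?_, fun hz => ?_⟩⟩
    · obtain ⟨c, rfl⟩ := ih z hz (hy.of_mem hz)
      rcases h.trichotomy c b with hcb | rfl | hbc
      · exact hlt hcb
      · exact (hb hz).elim
      · exact (hb ((isOrdIn_iff.1 hy).1 _ hz _ (hlt hbc))).elim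
    · obtain ⟨c, hc, rfl⟩ := hmem.1 hz
      exact hmin c hc
  refine ⟨graph E fun x y => y = F x, ?_, isClassRel_graph _, ?_, ?_, ?_, ?_⟩
  · have : Def2 E A fun x y => y = F x := ⟨by infer_instance⟩
    exact graph_mem_defClasses
  all_goals simp only [pairIn_graph, Set.mem_univ, true_implies, true_and]
  · rintro x _ _ rfl rfl; rfl
  · rintro x x' y rfl e; exact hinj e
  · exact fun x => ⟨_, rfl, hord x⟩
  · exact hsurj

theorem GlobalChoice.exists_wellOrd (h : GlobalChoice Set.univ E (defClasses E A)) :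
    ∃ lt, WellOrd E A lt := by
  obtain ⟨F, hF, -, hfun, hinj, htot, -⟩ := h
  have : Def1 E A (· ∈ F) := hF
  have hd : Def2 E A (PairIn Set.univ E F) := def2_pairIn
  choose f hf hord using fun x => htot x trivial
  have hPf {x y : α} : PairIn Set.univ E F x y ↔ y = f x :=
    ⟨fun h => hfun x y _ h (hf x), fun h => h ▸ hf x⟩
  have hfd : DefF1 E A f :=
    ⟨⟨(inferInstance : Dfn E A fun t => PairIn Set.univ E F (t 1) (t 0)).of_iff
      fun t => hPf.symm⟩⟩
  have hfinj {x y : α} (e : f x = f y) : x = y := hinj x y _ (hf x) (e ▸ hf y)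
  refine ⟨fun x y => E (f x) (f y), ⟨by infer_instance⟩, fun x => mem_irrefl _,
    fun {x y z} h h' => (isOrdIn_iff.1 (hord z)).1 _ h' _ h, fun x y => ?_, ?_, fun a => ?_⟩
  · exact (IsOrdIn.trichotomy A _ _ (hord x) (hord y)).imp id (Or.imp hfinj id)
  · rintro d ⟨z, hz⟩
    obtain ⟨s, hs⟩ := (isSet_mem (E := E) d).imageF A f
    obtain ⟨m, hm, hmin⟩ := SetAxioms.foundation (E := E) s ⟨f z, (hs _).2 ⟨z, hz, rfl⟩⟩
    obtain ⟨x, hx, rfl⟩ := (hs m).1 hm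
    exact ⟨x, hx, fun y hy hlt => hmin _ hlt ((hs _).2 ⟨y, hy, rfl⟩)⟩
  · obtain ⟨d, hd⟩ := (isSet_mem (E := E) (f a)).image A (fun z x => z = f x)
      fun z x y _ hx hy => hfinj (hx.symm.trans hy)
    exact ⟨d, fun b hb => (hd b).2 ⟨_, hb, rfl⟩⟩

end GlobalChoice

/-- A countable model of `ZFC` has a minimum `GBC`-realization iff it
has a global well-order definable from set parameters; in that case the minimum
`GBC`-realization is `Def(M)`. -/
theorem minimum_GBC_realization {α : Type} (E : α → α → Prop) (hcnt : Countable α)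
    (hzf : ZFModel (Set.univ : Set α) E) (hac : SatAC Set.univ E) :
    ((∃ 𝒳 : Set (Set α), GBC Set.univ E 𝒳 ∧
        ∀ 𝒴 : Set (Set α), GBC Set.univ E 𝒴 → 𝒳 ⊆ 𝒴) ↔
      (∃ W ∈ Def0 (Set.univ : Set α) E, IsGWO Set.univ E W)) ∧
    ∀ 𝒳 : Set (Set α),
      (GBC Set.univ E 𝒳 ∧ ∀ 𝒴 : Set (Set α), GBC Set.univ E 𝒴 → 𝒳 ⊆ 𝒴) →
      𝒳 = Def0 Set.univ E := by
  have : Nonempty α := ⟨hzf.nonempty.choose⟩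
  have := hzf.setAxioms
  have := hzf.replacement_empty
  have sub {𝒳 : Set (Set α)} (h : GBC Set.univ E 𝒳) : Def0 Set.univ E ⊆ 𝒳 :=
    def0_subset_of_gbModel h.1 (h.2.imp fun _ h => h.1)
  have key (𝒳 : Set (Set α))
      (h : GBC Set.univ E 𝒳 ∧ ∀ 𝒴 : Set (Set α), GBC Set.univ E 𝒴 → 𝒳 ⊆ 𝒴) :
      𝒳 = Def0 Set.univ E := by
    refine (Set.Subset.antisymm ?_ (sub h.1))
    rw [def0_eq_defClasses]
    intro X hX
    by_contra hXd
    obtain ⟨A, hA, hXA, lt, hlt⟩ := exists_wellOrd_not_def1 hac hXd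
    exact hXA (h.2 _ ⟨gbModel_defClasses hzf, hlt.globalChoice⟩ hX)
  refine ⟨⟨?_, ?_⟩, key⟩
  · rintro ⟨𝒳, h⟩
    have hgc := h.1.2
    rw [key 𝒳 h, def0_eq_defClasses] at hgc
    obtain ⟨lt, hlt⟩ := hgc.exists_wellOrd
    have := hlt.def2
    rw [def0_eq_defClasses]
    exact ⟨_, graph_mem_defClasses, hlt.isGWO⟩
  · rintro ⟨W, hW, hgwo⟩
    rw [def0_eq_defClasses] at hW
    refine ⟨Def0 Set.univ E, ?_, fun 𝒴 => sub⟩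
    rw [def0_eq_defClasses]
    exact ⟨gbModel_defClasses hzf, (hgwo.wellOrd hW).globalChoice⟩

end SOST
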